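/- arXiv:math/0609291 — 5 statements merged into one kernel-verified Lean document; each statement's English description precedes it below -/
import Mathlib

section
/- Let C be a semidualizing module over a commutative noetherian ring R. Then the Bass class B_C is preenveloping: every R-module has a B_C-preenvelope. -/
/-!
Common definitions: Ext/Tor vanishing, semidualizing modules, the Auslander and Bass
classes, (pre)covers and (pre)envelopes, cotorsion pairs, the classes `I_C` and `F_C`,
purity, and Kaplansky classes.
-/

open CategoryTheory

universe u

noncomputable section

/-- `Ext^j_R(A,B) = 0`. -/
def extVanishes (R : Type u) [CommRing R] (A B : ModuleCat.{u} R) (j : ℕ) : Prop :=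
  Subsingleton (((Ext R (ModuleCat.{u} R) j).obj (Opposite.op A)).obj B)

/-- `Tor_j^R(A,B) = 0`. -/
def torVanishes (R : Type u) [CommRing R] (A B : ModuleCat.{u} R) (j : ℕ) : Prop :=
  Subsingleton (((Tor (ModuleCat.{u} R) j).obj A).obj B)

/-- A semidualizing module: finitely generated, `Ext^j(C,C) = 0` for all `j > 0`, and the
homothety map `χ_C : R → Hom_R(C,C)`, `r ↦ r • id`, is an isomorphism (bijective). -/
def IsSemidualizing (R : Type u) [CommRing R] (C : Type u) [AddCommGroup C] [Module R C] :
    Prop :=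
  Module.Finite R C ∧
  (∀ j : ℕ, 0 < j → extVanishes R (ModuleCat.of R C) (ModuleCat.of R C) j) ∧
  Function.Bijective (fun r : R => r • (LinearMap.id : C →ₗ[R] C))

/-- The natural map `η_M : M → Hom_R(C, C ⊗_R M)`, `m ↦ (c ↦ c ⊗ m)`. -/
def etaMap (R : Type u) [CommRing R] (C : Type u) [AddCommGroup C] [Module R C]
    (M : Type u) [AddCommGroup M] [Module R M] :
    M →ₗ[R] (C →ₗ[R] TensorProduct R C M) :=
  (TensorProduct.mk R C M).flip

/-- The evaluation map `ε_N : C ⊗_R Hom_R(C,N) → N`, `c ⊗ f ↦ f c`. -/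
def epsMap (R : Type u) [CommRing R] (C : Type u) [AddCommGroup C] [Module R C]
    (N : Type u) [AddCommGroup N] [Module R N] :
    TensorProduct R C (C →ₗ[R] N) →ₗ[R] N :=
  TensorProduct.lift (LinearMap.id (R := R) (M := C →ₗ[R] N)).flip

/-- Membership in the Auslander class `A_C`. -/
def memAuslander (R : Type u) [CommRing R] (C : Type u) [AddCommGroup C] [Module R C]
    (M : ModuleCat.{u} R) : Prop :=
  (∀ j : ℕ, 0 < j → torVanishes R (ModuleCat.of R C) M j) ∧
  (∀ j : ℕ, 0 < j →
    extVanishes R (ModuleCat.of R C) (ModuleCat.of R (TensorProduct R C M)) j) ∧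
  Function.Bijective (etaMap R C M)

/-- Membership in the Bass class `B_C`. -/
def memBass (R : Type u) [CommRing R] (C : Type u) [AddCommGroup C] [Module R C]
    (N : ModuleCat.{u} R) : Prop :=
  (∀ j : ℕ, 0 < j → extVanishes R (ModuleCat.of R C) N j) ∧
  (∀ j : ℕ, 0 < j →
    torVanishes R (ModuleCat.of R C) (ModuleCat.of R (C →ₗ[R] N)) j) ∧
  Function.Bijective (epsMap R C N)

/-- The Auslander class `A_C` as a class of modules. -/
def auslanderClass (R : Type u) [CommRing R] (C : Type u) [AddCommGroup C] [Module R C] :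
    Set (ModuleCat.{u} R) :=
  {M | memAuslander R C M}

/-- The Bass class `B_C` as a class of modules. -/
def bassClass (R : Type u) [CommRing R] (C : Type u) [AddCommGroup C] [Module R C] :
    Set (ModuleCat.{u} R) :=
  {N | memBass R C N}

variable (R : Type u) [CommRing R]

/-- `φ : F → M` is an `𝓕`-precover of `M`. -/
def IsPrecover (𝓕 : Set (ModuleCat.{u} R)) {F M : ModuleCat.{u} R} (φ : F ⟶ M) : Prop :=
  F ∈ 𝓕 ∧ ∀ F' ∈ 𝓕, ∀ φ' : F' ⟶ M, ∃ ψ : F' ⟶ F, ψ ≫ φ = φ'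

/-- `φ : F → M` is an `𝓕`-cover of `M`. -/
def IsCover (𝓕 : Set (ModuleCat.{u} R)) {F M : ModuleCat.{u} R} (φ : F ⟶ M) : Prop :=
  IsPrecover R 𝓕 φ ∧ ∀ f : F ⟶ F, f ≫ φ = φ → IsIso f

/-- `φ : M → F` is an `𝓕`-preenvelope of `M`. -/
def IsPreenvelope (𝓕 : Set (ModuleCat.{u} R)) {M F : ModuleCat.{u} R} (φ : M ⟶ F) : Prop :=
  F ∈ 𝓕 ∧ ∀ F' ∈ 𝓕, ∀ φ' : M ⟶ F', ∃ ψ : F ⟶ F', φ ≫ ψ = φ'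

/-- `φ : M → F` is an `𝓕`-envelope of `M`. -/
def IsEnvelope (𝓕 : Set (ModuleCat.{u} R)) {M F : ModuleCat.{u} R} (φ : M ⟶ F) : Prop :=
  IsPreenvelope R 𝓕 φ ∧ ∀ f : F ⟶ F, φ ≫ f = φ → IsIso f

/-- The class `𝓕` is precovering. -/
def Precovering (𝓕 : Set (ModuleCat.{u} R)) : Prop :=
  ∀ M : ModuleCat.{u} R, ∃ (F : ModuleCat.{u} R) (φ : F ⟶ M), IsPrecover R 𝓕 φ

/-- The class `𝓕` is covering. -/
def Covering (𝓕 : Set (ModuleCat.{u} R)) : Prop :=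
  ∀ M : ModuleCat.{u} R, ∃ (F : ModuleCat.{u} R) (φ : F ⟶ M), IsCover R 𝓕 φ

/-- The class `𝓕` is preenveloping. -/
def Preenveloping (𝓕 : Set (ModuleCat.{u} R)) : Prop :=
  ∀ M : ModuleCat.{u} R, ∃ (F : ModuleCat.{u} R) (φ : M ⟶ F), IsPreenvelope R 𝓕 φ

/-- The class `𝓕` is enveloping. -/
def Enveloping (𝓕 : Set (ModuleCat.{u} R)) : Prop :=
  ∀ M : ModuleCat.{u} R, ∃ (F : ModuleCat.{u} R) (φ : M ⟶ F), IsEnvelope R 𝓕 φ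

/-- `𝓕^⊥ = {N | Ext^1(F,N) = 0 for all F ∈ 𝓕}`. -/
def rightPerp (𝓕 : Set (ModuleCat.{u} R)) : Set (ModuleCat.{u} R) :=
  {N | ∀ F ∈ 𝓕, extVanishes R F N 1}

/-- `^⊥𝓖 = {M | Ext^1(M,G) = 0 for all G ∈ 𝓖}`. -/
def leftPerp (𝓖 : Set (ModuleCat.{u} R)) : Set (ModuleCat.{u} R) :=
  {M | ∀ G ∈ 𝓖, extVanishes R M G 1}

/-- `(𝓕, 𝓖)` is a cotorsion pair. -/
def IsCotorsionPair (𝓕 𝓖 : Set (ModuleCat.{u} R)) : Prop :=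
  rightPerp R 𝓕 = 𝓖 ∧ leftPerp R 𝓖 = 𝓕

/-- `(𝓕, 𝓖)` is a perfect cotorsion pair: a cotorsion pair with `𝓕` covering and
`𝓖` enveloping. -/
def IsPerfectCotorsionPair (𝓕 𝓖 : Set (ModuleCat.{u} R)) : Prop :=
  IsCotorsionPair R 𝓕 𝓖 ∧ Covering R 𝓕 ∧ Enveloping R 𝓖

variable (C : Type u) [AddCommGroup C] [Module R C]

/-- The class `I_C` of modules isomorphic to `Hom_R(C, I)` for an injective module `I`. -/
def memIC (V : ModuleCat.{u} R) : Prop :=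
  ∃ I : ModuleCat.{u} R, Module.Injective R I ∧ Nonempty (V ≃ₗ[R] (C →ₗ[R] I))

/-- The class `F_C` of modules isomorphic to `C ⊗_R F` for a flat module `F`. -/
def memFC (V : ModuleCat.{u} R) : Prop :=
  ∃ F : ModuleCat.{u} R, Module.Flat R F ∧ Nonempty (V ≃ₗ[R] TensorProduct R C F)

/-- A short exact sequence `0 → A → B → D → 0` (given by `f` and `g`) is pure exact:
it is exact and remains exact after applying `P ⊗_R −` for every `R`-module `P`. -/
def IsPureExactSeq {A B D : Type u} [AddCommGroup A] [Module R A] [AddCommGroup B]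
    [Module R B] [AddCommGroup D] [Module R D] (f : A →ₗ[R] B) (g : B →ₗ[R] D) : Prop :=
  Function.Injective f ∧ Function.Exact f g ∧ Function.Surjective g ∧
  ∀ (P : Type u) [AddCommGroup P] [Module R P],
    Function.Injective (LinearMap.lTensor P f) ∧
    Function.Exact (LinearMap.lTensor P f) (LinearMap.lTensor P g) ∧
    Function.Surjective (LinearMap.lTensor P g)

/-- A submodule is pure if tensoring the inclusion with any module keeps it injective. -/
def IsPureSubmodule {E : Type u} [AddCommGroup E] [Module R E] (A : Submodule R E) : Prop :=
  ∀ (P : Type u) [AddCommGroup P] [Module R P],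
    Function.Injective (LinearMap.lTensor P A.subtype)

/-- `𝓕` is a Kaplansky class. -/
def KaplanskyClass (𝓕 : Set (ModuleCat.{u} R)) : Prop :=
  ∃ lam : Cardinal.{u}, ∀ M ∈ 𝓕, ∀ x : M, ∃ M' : Submodule R M,
    x ∈ M' ∧ Cardinal.mk M' ≤ lam ∧
    ModuleCat.of R M' ∈ 𝓕 ∧ ModuleCat.of R (M ⧸ M') ∈ 𝓕

end

open Limits ZeroObject

attribute [local instance] Cardinal.fact_isRegular_aleph0 Cardinal.orderBotAleph0OrdToType

lemma hasCardinalLT_arrow_of_finCategory (J : Type) [SmallCategory J] [FinCategory J] :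
    HasCardinalLT (Arrow J) Cardinal.aleph0.{u} := by
  rw [hasCardinalLT_aleph0_iff]
  exact Finite.of_equiv _ (Arrow.equivSigma J).symm

/-- `R` represents the forgetful functor, which preserves filtered colimits. -/
lemma isFinitelyPresentable_self (R : Type u) [CommRing R] :
    IsFinitelyPresentable.{u} (ModuleCat.of R R) := by
  rw [isFinitelyPresentable_iff_preservesFilteredColimits]
  let e : forget (ModuleCat.{u} R) ≅ coyoneda.obj (Opposite.op (ModuleCat.of R R)) :=
    NatIso.ofComponents (fun M ↦ Equiv.toIso
      ((LinearMap.ringLmapEquivSelf R R M).symm.toEquiv.trans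
        (ModuleCat.homEquiv (M := ModuleCat.of R R) (N := M)).symm)) (by
        intro M N f
        ext x
        apply ModuleCat.hom_ext
        apply LinearMap.ext_ring
        simp [ModuleCat.homEquiv])
  exact ⟨fun J _ _ ↦ preservesColimitsOfShape_of_natIso e⟩

lemma isFinitelyPresentable_pi (R : Type u) [CommRing R] (n : ℕ) :
    IsFinitelyPresentable.{u} (ModuleCat.of R (Fin n → R)) := by
  have := isFinitelyPresentable_self R
  let c : Cofan (fun _ : Fin n ↦ ModuleCat.of R R) := Cofan.mk (ModuleCat.of R (Fin n → R))
    (fun i ↦ ModuleCat.ofHom (LinearMap.single R (fun _ ↦ R) i))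
  have hc : IsColimit c := Cofan.IsColimit.mk _
    (fun s ↦ ModuleCat.ofHom (LinearMap.lsum R (fun _ ↦ R) R (fun i ↦ (s.inj i).hom)))
    (fun s i ↦ ModuleCat.hom_ext (LinearMap.ext fun x ↦
      LinearMap.lsum_piSingle R (fun _ ↦ R) R _ i x))
    (fun s m hm ↦ by
      apply ModuleCat.hom_ext
      refine LinearMap.pi_ext fun i x ↦ ?_
      rw [ModuleCat.hom_ofHom, LinearMap.lsum_piSingle, ← hm i]
      rfl)
  have (k : Discrete (Fin n)) :
      IsFinitelyPresentable.{u} ((Discrete.functor fun _ : Fin n ↦ ModuleCat.of R R).obj k) := this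
  exact isCardinalPresentable_of_isColimit' c hc _ (hasCardinalLT_arrow_of_finCategory _)

lemma isFinitelyPresentable_of_finitePresentation {R : Type u} [CommRing R] (M : ModuleCat.{u} R)
    [Module.FinitePresentation R M] : IsFinitelyPresentable.{u} M := by
  obtain ⟨n, m, f, g, hf, hgf⟩ := Module.FinitePresentation.exists_fin' R M
  let S : ShortComplex (ModuleCat.{u} R) := ShortComplex.mk (ModuleCat.ofHom g) (ModuleCat.ofHom f)
    (by rw [← ModuleCat.ofHom_comp, hgf.linearMap_comp_eq_zero]; rfl)
  have hS : S.Exact := (ShortComplex.ShortExact.moduleCat_exact_iff_function_exact S).2 hgf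
  have : Epi S.g := (ModuleCat.epi_iff_surjective _).2 hf
  have (k : WalkingParallelPair) :
      IsFinitelyPresentable.{u} ((parallelPair (ModuleCat.ofHom g) 0).obj k) := by
    cases k <;> exact isFinitelyPresentable_pi R _
  exact isCardinalPresentable_of_isColimit' _ hS.gIsCokernel _
    (hasCardinalLT_arrow_of_finCategory _)

/-- By the small object argument, the modules which are injective relatively to a set of
morphisms with finitely presented source form a preenveloping class. -/
lemma preenveloping_of_isSmall (R : Type u) [CommRing R] (W : MorphismProperty (ModuleCat.{u} R))
    [MorphismProperty.IsSmall.{u} W]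
    (hW : ∀ ⦃A B : ModuleCat.{u} R⦄ (i : A ⟶ B), W i → Module.FinitePresentation R A) :
    Preenveloping R {N | ∀ ⦃A B : ModuleCat.{u} R⦄ (i : A ⟶ B), W i →
      ∀ f : A ⟶ N, ∃ g : B ⟶ N, i ≫ g = f} := by
  have : MorphismProperty.IsCardinalForSmallObjectArgument W Cardinal.aleph0.{u} :=
    { preservesColimit {A B X Y} i hi f hf := by
        have := hW i hi
        have := isFinitelyPresentable_of_finitePresentation A
        infer_instance }
  have : MorphismProperty.HasSmallObjectArgument.{u} W :=
    ⟨.aleph0, inferInstance, inferInstance, inferInstance⟩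
  intro M
  let D := MorphismProperty.factorizationData W.rlp.llp W.rlp (0 : M ⟶ 0)
  refine ⟨D.Z, D.i, fun A B i hi f ↦ ?_, fun F' hF' φ ↦ ?_⟩
  · have := D.hp i hi
    have sq : CommSq f i D.p 0 := ⟨(isZero_zero _).eq_of_tgt _ _⟩
    exact ⟨sq.lift, sq.fac_left⟩
  · have : W.rlp (0 : F' ⟶ 0) := fun A B i hi ↦ ⟨fun {f g} sq ↦ by
      obtain ⟨h, hh⟩ := hF' i hi f
      exact ⟨⟨⟨h, hh, (isZero_zero _).eq_of_tgt _ _⟩⟩⟩⟩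
    have := D.hi _ this
    have sq : CommSq φ D.i (0 : F' ⟶ 0) 0 := ⟨by simp⟩
    exact ⟨sq.lift, sq.fac_left⟩

/-- Iterated syzygies of a module `K 0`: exact sequences `0 → K (j + 1) → P j → K j → 0` with `P j`
free. -/
structure SyzygySequence (R : Type u) [CommRing R] where
  K : ℕ → ModuleCat.{u} R
  P : ℕ → ModuleCat.{u} R
  ι : ∀ j, K (j + 1) →ₗ[R] P j
  π : ∀ j, P j →ₗ[R] K j
  ι_injective : ∀ j, Function.Injective (ι j)
  exact : ∀ j, Function.Exact (ι j) (π j)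
  π_surjective : ∀ j, Function.Surjective (π j)
  free : ∀ j, Module.Free R (P j)

namespace SyzygySequence

variable {R : Type u} [CommRing R]

attribute [instance] free

lemma exists_of_step (Q : ModuleCat.{u} R → Prop)
    (hQ : ∀ M, Q M → ∃ (P : ModuleCat.{u} R) (π : P →ₗ[R] M), Function.Surjective π ∧
      Module.Free R P ∧ Q P ∧ Q (ModuleCat.of R (LinearMap.ker π)))
    (M : ModuleCat.{u} R) (hM : Q M) :
    ∃ S : SyzygySequence R, S.K 0 = M ∧ ∀ j, Q (S.K j) ∧ Q (S.P j) := by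
  choose P π hπ hfree hQP hQK using hQ
  let K : ℕ → {M // Q M} := fun j ↦ j.rec ⟨M, hM⟩ (fun _ N ↦ ⟨_, hQK N.1 N.2⟩)
  exact ⟨{
    K := fun j ↦ (K j).1
    P := fun j ↦ P (K j).1 (K j).2
    ι := fun j ↦ (LinearMap.ker (π (K j).1 (K j).2)).subtype
    π := fun j ↦ π (K j).1 (K j).2
    ι_injective := fun j ↦ Subtype.val_injective
    exact := fun j ↦ LinearMap.exact_subtype_ker_map _
    π_surjective := fun j ↦ hπ _ _
    free := fun j ↦ hfree _ _ }, rfl, fun j ↦ ⟨(K j).2, hQP _ _⟩⟩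

lemma exists_of_module (M : ModuleCat.{u} R) : ∃ S : SyzygySequence R, S.K 0 = M := by
  obtain ⟨S, hS, -⟩ := exists_of_step (R := R) (fun _ ↦ True) (fun N _ ↦
    ⟨ModuleCat.of R (N →₀ R), Finsupp.linearCombination R id,
      Finsupp.linearCombination_id_surjective R N, inferInstance, trivial, trivial⟩) M trivial
  exact ⟨S, hS⟩

lemma exists_of_finite [IsNoetherianRing R] (M : ModuleCat.{u} R) [hM : Module.Finite R M] :
    ∃ S : SyzygySequence R, S.K 0 = M ∧ ∀ j, Module.Finite R (S.K j) ∧ Module.Finite R (S.P j) :=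
  exists_of_step (R := R) (fun N ↦ Module.Finite R N) (fun N _ ↦ by
    obtain ⟨n, f, hf⟩ := Module.Finite.exists_fin' R N
    exact ⟨ModuleCat.of R (Fin n → R), f, hf, inferInstance, inferInstance, inferInstance⟩) M hM

variable (S : SyzygySequence R)

/-- The differential of the free resolution spliced from the syzygy sequences. -/
def d (j : ℕ) : S.P (j + 1) →ₗ[R] S.P j := S.ι j ∘ₗ S.π (j + 1)

lemma exact_d_π (j : ℕ) : Function.Exact (S.d j) (S.π j) :=
  (S.π_surjective (j + 1)).comp_exact_iff_exact.2 (S.exact j)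

lemma exact_d_d (j : ℕ) : Function.Exact (S.d (j + 1)) (S.d j) :=
  (S.ι_injective j).comp_exact_iff_exact.2 (S.exact_d_π (j + 1))

/-- The free resolution of `K 0` as a chain complex. -/
noncomputable def complex : ChainComplex (ModuleCat.{u} R) ℕ :=
  ChainComplex.of S.P (fun j ↦ ModuleCat.ofHom (S.d j)) fun j ↦ by
    rw [← ModuleCat.ofHom_comp, (S.exact_d_d j).linearMap_comp_eq_zero]
    rfl

lemma complex_d (j : ℕ) : S.complex.d (j + 1) j = ModuleCat.ofHom (S.d j) :=
  ChainComplex.of_d S.P (fun j ↦ ModuleCat.ofHom (S.d j)) j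

lemma complex_d_comp_π :
    (S.complex.d 1 0 ≫ ModuleCat.ofHom (S.π 0) : S.P 1 ⟶ S.K 0) = 0 := by
  rw [complex_d]
  apply ModuleCat.hom_ext
  exact (S.exact_d_π 0).linearMap_comp_eq_zero

lemma complex_exactAt_succ (j : ℕ) : S.complex.ExactAt (j + 1) := by
  rw [HomologicalComplex.exactAt_iff' _ (j + 1 + 1) (j + 1) j (by simp) (by simp),
    ShortComplex.ShortExact.moduleCat_exact_iff_function_exact]
  change Function.Exact (S.complex.d (j + 1 + 1) (j + 1)).hom (S.complex.d (j + 1) j).hom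
  rw [complex_d, complex_d]
  exact S.exact_d_d j

/-- The free resolution of `K 0` as a projective resolution. -/
noncomputable def projectiveResolution : ProjectiveResolution (S.K 0) where
  complex := S.complex
  projective j := inferInstanceAs (Projective (S.P j))
  π := (ChainComplex.toSingle₀Equiv _ _).symm ⟨ModuleCat.ofHom (S.π 0), S.complex_d_comp_π⟩
  quasiIso := ⟨fun n ↦ by
    cases n
    · rw [ChainComplex.quasiIsoAt₀_iff, ShortComplex.quasiIso_iff_of_zeros']
      · let T : ShortComplex (ModuleCat.{u} R) := ShortComplex.mk (ModuleCat.ofHom (S.d 0))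
          (ModuleCat.ofHom (S.π 0)) (by
            apply ModuleCat.hom_ext
            exact (S.exact_d_π 0).linearMap_comp_eq_zero)
        have hT : T.Exact := (ShortComplex.ShortExact.moduleCat_exact_iff_function_exact T).2
          (S.exact_d_π 0)
        have : Epi T.g := (ModuleCat.epi_iff_surjective _).2 (S.π_surjective 0)
        refine (ShortComplex.exact_and_epi_g_iff_of_iso ?_).2 ⟨hT, this⟩
        refine ShortComplex.isoMk (Iso.refl _) (Iso.refl _) (Iso.refl _) ?_ ?_
        · change 𝟙 _ ≫ ModuleCat.ofHom (S.d 0) = S.complex.d 1 0 ≫ 𝟙 _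
          rw [complex_d]
          rfl
        · change 𝟙 _ ≫ ModuleCat.ofHom (S.π 0) =
            ((ChainComplex.toSingle₀Equiv S.complex (S.K 0)).symm _).f 0 ≫ 𝟙 _
          refine (ModuleCat.hom_ext ?_)
          exact congrArg ModuleCat.Hom.hom (ChainComplex.toSingle₀Equiv_symm_apply_f_zero
            (C := S.complex) (X := S.K 0) (ModuleCat.ofHom (S.π 0)) S.complex_d_comp_π).symm
      all_goals rfl
    · rw [quasiIsoAt_iff_exactAt']
      · apply complex_exactAt_succ
      · apply ChainComplex.exactAt_succ_single_obj⟩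

lemma extVanishes_iff (N : ModuleCat.{u} R) (j : ℕ) :
    extVanishes R (S.K 0) N (j + 1) ↔
      Function.Exact ((S.d j).lcomp R N) ((S.d (j + 1)).lcomp R N) := by
  rw [extVanishes, ← ModuleCat.isZero_iff_subsingleton,
    (S.projectiveResolution.isoExt (R := R) (j + 1) N).isZero_iff,
    ← HomologicalComplex.exactAt_iff_isZero_homology,
    HomologicalComplex.exactAt_iff' _ j (j + 1) (j + 1 + 1) (by simp) (by simp),
    ShortComplex.ShortExact.moduleCat_exact_iff_function_exact]
  change Function.Exact (fun f : S.P j ⟶ N ↦ S.complex.d (j + 1) j ≫ f)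
    (fun f : S.P (j + 1) ⟶ N ↦ S.complex.d (j + 1 + 1) (j + 1) ≫ f) ↔ _
  rw [complex_d, complex_d]
  let e (k : ℕ) : (S.P k ⟶ N) ≃ₗ[R] (S.P k →ₗ[R] N) := ModuleCat.homLinearEquiv
  exact (Function.Exact.iff_of_ladder_linearEquiv (e₁ := e j) (e₂ := e (j + 1))
    (e₃ := e (j + 1 + 1)) (f₁₂ := Linear.leftComp R N (ModuleCat.ofHom (S.d j)))
    (f₂₃ := Linear.leftComp R N (ModuleCat.ofHom (S.d (j + 1))))
    (LinearMap.ext fun _ ↦ rfl) (LinearMap.ext fun _ ↦ rfl)).symm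

lemma torVanishes_iff (M : ModuleCat.{u} R) (j : ℕ) :
    torVanishes R M (S.K 0) (j + 1) ↔
      Function.Exact ((S.d (j + 1)).lTensor M) ((S.d j).lTensor M) := by
  rw [torVanishes, ← ModuleCat.isZero_iff_subsingleton]
  change Limits.IsZero ((((MonoidalCategory.tensoringLeft (ModuleCat.{u} R)).obj M).leftDerived
    (j + 1)).obj (S.K 0)) ↔ _
  rw [(S.projectiveResolution.isoLeftDerivedObj
    ((MonoidalCategory.tensoringLeft (ModuleCat.{u} R)).obj M) (j + 1)).isZero_iff]
  change Limits.IsZero (HomologicalComplex.homology _ _) ↔ _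
  rw [← HomologicalComplex.exactAt_iff_isZero_homology,
    HomologicalComplex.exactAt_iff' _ (j + 1 + 1) (j + 1) j (by simp) (by simp),
    ShortComplex.ShortExact.moduleCat_exact_iff_function_exact]
  change Function.Exact (LinearMap.lTensor M (S.complex.d (j + 1 + 1) (j + 1)).hom)
    (LinearMap.lTensor M (S.complex.d (j + 1) j).hom) ↔ _
  rw [complex_d, complex_d]
  rfl

end SyzygySequence

section Balance

open TensorProduct

variable {R : Type*} [CommRing R]

lemma injective_iff_exact_comp {X Y Z W : Type*} [AddCommGroup X] [AddCommGroup Y]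
    [AddCommGroup Z] [AddCommGroup W] [Module R X] [Module R Y] [Module R Z] [Module R W]
    {a : X →ₗ[R] Y} {b : Y →ₗ[R] Z} (c : Z →ₗ[R] W) (hab : Function.Exact a b)
    (hb : Function.Surjective b) : Function.Injective c ↔ Function.Exact a (c ∘ₗ b) := by
  refine ⟨fun hc ↦ hc.comp_exact_iff_exact.2 hab, fun h ↦ ?_⟩
  rw [injective_iff_map_eq_zero]
  intro z hz
  obtain ⟨y, rfl⟩ := hb z
  exact (hab y).2 ((h y).1 hz)

variable {K P A L F B : Type*} [AddCommGroup K] [AddCommGroup P] [AddCommGroup A]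
  [AddCommGroup L] [AddCommGroup F] [AddCommGroup B] [Module R K] [Module R P] [Module R A]
  [Module R L] [Module R F] [Module R B]

lemma rTensor_injective_iff_lTensor (M : Type*) [AddCommGroup M] [Module R M] (f : K →ₗ[R] P) :
    Function.Injective (f.rTensor M) ↔ Function.Injective (f.lTensor M) := by
  rw [← LinearMap.comm_comp_rTensor_comp_comm_eq]
  simp

/-- One half of the symmetry of `Tor₁`. -/
lemma rTensor_injective_of_lTensor [Module.Flat R F] {i : K →ₗ[R] P} {p : P →ₗ[R] A}
    {k : L →ₗ[R] F} {q : F →ₗ[R] B} (hi : Function.Injective i) (hip : Function.Exact i p)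
    (hp : Function.Surjective p) (hkq : Function.Exact k q) (hq : Function.Surjective q)
    (h : Function.Injective (k.lTensor A)) : Function.Injective (i.rTensor B) := by
  rw [injective_iff_map_eq_zero]
  intro x hx
  obtain ⟨y, rfl⟩ := LinearMap.lTensor_surjective K hq x
  have hy : q.lTensor P (i.rTensor F y) = 0 := by
    rw [← hx, ← LinearMap.comp_apply, ← LinearMap.comp_apply, LinearMap.lTensor_comp_rTensor,
      LinearMap.rTensor_comp_lTensor]
  obtain ⟨z, hz⟩ := (lTensor_exact P hkq hq _).1 hy
  have hz' : p.rTensor L z = 0 := by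
    apply h
    rw [map_zero, ← LinearMap.comp_apply, LinearMap.lTensor_comp_rTensor,
      ← LinearMap.rTensor_comp_lTensor, LinearMap.comp_apply, hz]
    exact (rTensor_exact F hip hp).apply_apply_eq_zero y
  obtain ⟨w, rfl⟩ := (rTensor_exact L hip hp z).1 hz'
  have hw : k.lTensor K w = y := by
    apply Module.Flat.rTensor_preserves_injective_linearMap (M := F) i hi
    rw [← hz, ← LinearMap.comp_apply, ← LinearMap.comp_apply, LinearMap.lTensor_comp_rTensor,
      LinearMap.rTensor_comp_lTensor]
  rw [← hw]
  exact (lTensor_exact K hkq hq).apply_apply_eq_zero w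

/-- The symmetry of `Tor₁`. -/
lemma lTensor_injective_iff_rTensor [Module.Flat R P] [Module.Flat R F] {i : K →ₗ[R] P}
    {p : P →ₗ[R] A} {k : L →ₗ[R] F} {q : F →ₗ[R] B} (hi : Function.Injective i)
    (hip : Function.Exact i p) (hp : Function.Surjective p) (hk : Function.Injective k)
    (hkq : Function.Exact k q) (hq : Function.Surjective q) :
    Function.Injective (k.lTensor A) ↔ Function.Injective (i.rTensor B) := by
  refine ⟨rTensor_injective_of_lTensor hi hip hp hkq hq, fun h ↦ ?_⟩
  rw [← rTensor_injective_iff_lTensor]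
  exact rTensor_injective_of_lTensor hk hkq hq hip hp ((rTensor_injective_iff_lTensor _ _).1 h)

lemma rTensor_injective_iff_lTensor_of_flat [Module.Flat R P] [Module.Flat R F] {i : K →ₗ[R] P}
    {k : L →ₗ[R] F} (hi : Function.Injective i) (hk : Function.Injective k) :
    Function.Injective (i.rTensor L) ↔ Function.Injective (k.lTensor K) := by
  have hP := Module.Flat.lTensor_preserves_injective_linearMap (M := P) k hk
  have hF := Module.Flat.rTensor_preserves_injective_linearMap (M := F) i hi
  rw [← hP.of_comp_iff, ← hF.of_comp_iff, ← LinearMap.coe_comp, ← LinearMap.coe_comp,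
    LinearMap.lTensor_comp_rTensor, LinearMap.rTensor_comp_lTensor]

end Balance

namespace SyzygySequence

variable {R : Type u} [CommRing R] (S T : SyzygySequence R)

lemma lTensor_ι_injective_iff (M : Type*) [AddCommGroup M] [Module R M] (j : ℕ) :
    Function.Injective ((S.ι j).lTensor M) ↔
      Function.Exact ((S.d (j + 1)).lTensor M) ((S.d j).lTensor M) := by
  rw [injective_iff_exact_comp _ (lTensor_exact M (S.exact_d_π (j + 1)) (S.π_surjective _))
    (LinearMap.lTensor_surjective M (S.π_surjective _)), ← LinearMap.lTensor_comp]
  rfl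

lemma lTensor_injective_iff_rTensor (i j : ℕ) :
    Function.Injective ((T.ι j).lTensor (S.K i)) ↔
      Function.Injective ((S.ι i).rTensor (T.K j)) :=
  _root_.lTensor_injective_iff_rTensor (S.ι_injective i) (S.exact i) (S.π_surjective i)
    (T.ι_injective j) (T.exact j) (T.π_surjective j)

lemma lTensor_injective_iff_zero (i j : ℕ) :
    Function.Injective ((T.ι j).lTensor (S.K i)) ↔
      Function.Injective ((T.ι 0).lTensor (S.K (i + j))) := by
  induction j generalizing i with
  | zero => rfl
  | succ j ih =>
    rw [lTensor_injective_iff_rTensor, rTensor_injective_iff_lTensor_of_flat (S.ι_injective i)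
      (T.ι_injective j), ih, Nat.add_right_comm, Nat.add_assoc]

/-- `Tor` can be computed by resolving the first argument. -/
lemma torVanishes_iff' (M : ModuleCat.{u} R) (j : ℕ) :
    torVanishes R (S.K 0) M (j + 1) ↔
      Function.Exact ((S.d (j + 1)).lTensor M) ((S.d j).lTensor M) := by
  obtain ⟨T, rfl⟩ := exists_of_module M
  rw [torVanishes_iff, ← lTensor_ι_injective_iff, ← lTensor_ι_injective_iff,
    lTensor_injective_iff_zero, zero_add, lTensor_injective_iff_rTensor,
    rTensor_injective_iff_lTensor]

end SyzygySequence

section HomEval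

open TensorProduct

variable {R : Type*} [CommRing R] (P C N : Type*) [AddCommGroup P] [AddCommGroup C]
  [AddCommGroup N] [Module R P] [Module R C] [Module R N]

/-- The natural map `Hom(C, N) ⊗ P → Hom(Hom(P, C), N)`, `f ⊗ p ↦ (g ↦ f (g p))`. -/
noncomputable def homTensorEval : (C →ₗ[R] N) ⊗[R] P →ₗ[R] (P →ₗ[R] C) →ₗ[R] N :=
  TensorProduct.lift
    ((LinearMap.llcomp R (P →ₗ[R] C) C N).compl₂ (LinearMap.id (M := P →ₗ[R] C)).flip)

@[simp]
lemma homTensorEval_tmul (f : C →ₗ[R] N) (p : P) (g : P →ₗ[R] C) :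
    homTensorEval P C N (f ⊗ₜ p) g = f (g p) := rfl

lemma homTensorEval_bijective [Module.Free R P] [Module.Finite R P] :
    Function.Bijective (homTensorEval (R := R) P C N) := by
  let b := Module.Free.chooseBasis R P
  let inv (φ : (P →ₗ[R] C) →ₗ[R] N) : (C →ₗ[R] N) ⊗[R] P :=
    ∑ i, (φ ∘ₗ LinearMap.smulRightₗ (b.coord i)) ⊗ₜ b i
  refine Function.bijective_iff_has_inverse.2 ⟨inv, fun x ↦ ?_, fun φ ↦ LinearMap.ext fun g ↦ ?_⟩
  · induction x with
    | zero => simp [inv]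
    | add x y hx hy =>
      conv_rhs => rw [← hx, ← hy]
      simp [inv, LinearMap.add_comp, TensorProduct.add_tmul, Finset.sum_add_distrib]
    | tmul f p =>
      have h (i) : homTensorEval P C N (f ⊗ₜ p) ∘ₗ LinearMap.smulRightₗ (b.coord i) =
          b.coord i p • f := by
        ext
        simp
      simp only [inv, h, TensorProduct.smul_tmul, ← TensorProduct.tmul_sum]
      congr 1
      exact b.sum_repr p
  · simp only [inv, map_sum, LinearMap.sum_apply, homTensorEval_tmul, LinearMap.comp_apply]
    rw [← map_sum]
    congr 1
    refine b.ext fun k ↦ ?_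
    simp [LinearMap.sum_apply, Finsupp.single_apply]

/-- The map `homTensorEval` as an isomorphism, for `P` finite free. -/
noncomputable def homTensorEvalEquiv [Module.Free R P] [Module.Finite R P] :
    (C →ₗ[R] N) ⊗[R] P ≃ₗ[R] ((P →ₗ[R] C) →ₗ[R] N) :=
  LinearEquiv.ofBijective _ (homTensorEval_bijective P C N)

variable {P}

lemma lcomp_comp_homTensorEval {Q : Type*} [AddCommGroup Q] [Module R Q] (d : P →ₗ[R] Q) :
    (d.lcomp R C).lcomp R N ∘ₗ homTensorEval P C N =
      homTensorEval Q C N ∘ₗ d.lTensor (C →ₗ[R] N) := by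
  ext
  rfl

lemma lcomp_toSpanSingleton_comp_homTensorEval (π : P →ₗ[R] C) :
    (LinearMap.toSpanSingleton R (P →ₗ[R] C) π).lcomp R N ∘ₗ homTensorEval P C N =
      (LinearMap.ringLmapEquivSelf R R N).symm.toLinearMap ∘ₗ
        TensorProduct.lift (LinearMap.lcomp R N π) := by
  ext
  simp

end HomEval

lemma forall_pos_iff_forall_succ {p : ℕ → Prop} : (∀ j, 0 < j → p j) ↔ ∀ j, p (j + 1) :=
  ⟨fun h j ↦ h _ j.succ_pos, fun h j hj ↦ by
    obtain ⟨j, rfl⟩ := Nat.exists_eq_add_one.2 hj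
    exact h j⟩

namespace SyzygySequence

open TensorProduct

variable {R : Type u} [CommRing R] (S : SyzygySequence R) (N : ModuleCat.{u} R)

/-- The map `R → Hom(P 0, K 0)` sending `r` to `r • π 0`. -/
noncomputable def smulπ : R →ₗ[R] S.P 0 →ₗ[R] S.K 0 :=
  LinearMap.toSpanSingleton R _ (S.π 0)

lemma lcomp_comp_smulπ : (S.d 0).lcomp R (S.K 0) ∘ₗ S.smulπ = 0 := by
  apply LinearMap.ext_ring
  rw [LinearMap.comp_apply, smulπ, LinearMap.toSpanSingleton_apply, one_smul]
  exact (S.exact_d_π 0).linearMap_comp_eq_zero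

lemma lcomp_comp_lcomp (j : ℕ) :
    (S.d (j + 1)).lcomp R N ∘ₗ (S.d j).lcomp R N = 0 := by
  ext f x
  exact (congrArg f ((S.exact_d_d j).apply_apply_eq_zero x)).trans f.map_zero

lemma lift_lcomp_π_eq :
    TensorProduct.lift (LinearMap.lcomp R N (S.π 0)) =
      (epsMap R (S.K 0) N ∘ₗ (TensorProduct.comm R (S.K 0 →ₗ[R] N) (S.K 0)).toLinearMap) ∘ₗ
        (S.π 0).lTensor (S.K 0 →ₗ[R] N) := by
  ext
  rfl

lemma epsMap_injective_iff [∀ j, Module.Finite R (S.P j)] :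
    Function.Injective (epsMap R (S.K 0) N) ↔
      Function.Exact (((S.d 0).lcomp R (S.K 0)).lcomp R N) (S.smulπ.lcomp R N) := by
  rw [← EquivLike.injective_comp (TensorProduct.comm R (S.K 0 →ₗ[R] N) (S.K 0)).toEquiv]
  refine (injective_iff_exact_comp
    (epsMap R (S.K 0) N ∘ₗ (TensorProduct.comm R (S.K 0 →ₗ[R] N) (S.K 0)).toLinearMap)
    (lTensor_exact _ (S.exact_d_π 0) (S.π_surjective 0))
    (LinearMap.lTensor_surjective _ (S.π_surjective 0))).trans ?_
  rw [← lift_lcomp_π_eq]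
  exact (Function.Exact.iff_of_ladder_linearEquiv (e₁ := homTensorEvalEquiv (S.P 1) (S.K 0) N)
    (e₂ := homTensorEvalEquiv (S.P 0) (S.K 0) N) (e₃ := (LinearMap.ringLmapEquivSelf R R N).symm)
    (lcomp_comp_homTensorEval _ _ _)
    (lcomp_toSpanSingleton_comp_homTensorEval _ _ _)).symm

lemma epsMap_surjective_iff [∀ j, Module.Finite R (S.P j)] :
    Function.Surjective (epsMap R (S.K 0) N) ↔ Function.Surjective (S.smulπ.lcomp R N) := by
  rw [← (homTensorEval_bijective (S.P 0) (S.K 0) N).surjective.of_comp_iff, ← LinearMap.coe_comp,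
    smulπ, lcomp_toSpanSingleton_comp_homTensorEval, lift_lcomp_π_eq, LinearMap.coe_comp,
    LinearEquiv.coe_coe, EquivLike.comp_surjective, LinearMap.coe_comp,
    (LinearMap.lTensor_surjective _ (S.π_surjective 0)).of_comp_iff, LinearMap.coe_comp,
    LinearEquiv.coe_coe, EquivLike.surjective_comp]

lemma torVanishes_homModule_iff [∀ j, Module.Finite R (S.P j)] (j : ℕ) :
    torVanishes R (S.K 0) (ModuleCat.of R (S.K 0 →ₗ[R] N)) (j + 1) ↔
      Function.Exact (((S.d (j + 1)).lcomp R (S.K 0)).lcomp R N)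
        (((S.d j).lcomp R (S.K 0)).lcomp R N) := by
  rw [torVanishes_iff']
  exact (Function.Exact.iff_of_ladder_linearEquiv
    (e₁ := homTensorEvalEquiv (S.P (j + 1 + 1)) (S.K 0) N)
    (e₂ := homTensorEvalEquiv (S.P (j + 1)) (S.K 0) N)
    (e₃ := homTensorEvalEquiv (S.P j) (S.K 0) N)
    (lcomp_comp_homTensorEval _ _ _) (lcomp_comp_homTensorEval _ _ _)).symm

/-- Short complexes whose exactness after applying `Hom(-, N)` characterises that `N` belongs to
the Bass class of `K 0`. -/
noncomputable def bassComplex : (ℕ ⊕ ℕ) ⊕ Bool → ShortComplex (ModuleCat.{u} R)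
  | .inl (.inl j) => ShortComplex.mk (ModuleCat.ofHom (S.d (j + 1))) (ModuleCat.ofHom (S.d j))
      (ModuleCat.hom_ext (S.exact_d_d j).linearMap_comp_eq_zero)
  | .inl (.inr j) => ShortComplex.mk (ModuleCat.ofHom ((S.d j).lcomp R (S.K 0)))
      (ModuleCat.ofHom ((S.d (j + 1)).lcomp R (S.K 0)))
      (ModuleCat.hom_ext (S.lcomp_comp_lcomp (S.K 0) j))
  | .inr true => ShortComplex.mk (ModuleCat.ofHom S.smulπ)
      (ModuleCat.ofHom ((S.d 0).lcomp R (S.K 0))) (ModuleCat.hom_ext S.lcomp_comp_smulπ)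
  | .inr false => ShortComplex.mk (0 : ModuleCat.of R R ⟶ ModuleCat.of R R)
      (ModuleCat.ofHom S.smulπ) Limits.zero_comp

lemma finite_bassComplex_X₂ [IsNoetherianRing R] [Module.Finite R (S.K 0)]
    [∀ j, Module.Finite R (S.P j)] (i : (ℕ ⊕ ℕ) ⊕ Bool) :
    Module.Finite R (S.bassComplex i).X₂ := by
  rcases i with (j | j) | (_ | _)
  · exact inferInstanceAs (Module.Finite R (S.P (j + 1)))
  · exact inferInstanceAs (Module.Finite R (S.P (j + 1) →ₗ[R] S.K 0))
  · exact inferInstanceAs (Module.Finite R R)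
  · exact inferInstanceAs (Module.Finite R (S.P 0 →ₗ[R] S.K 0))

lemma memBass_iff [∀ j, Module.Finite R (S.P j)] :
    memBass R (S.K 0) N ↔ ∀ i, Function.Exact ((S.bassComplex i).g.hom.lcomp R N)
      ((S.bassComplex i).f.hom.lcomp R N) := by
  have h : Function.Surjective (S.smulπ.lcomp R N) ↔
      Function.Exact (S.smulπ.lcomp R N) ((0 : R →ₗ[R] R).lcomp R N) := by
    rw [← LinearMap.exact_zero_iff_surjective (R →ₗ[R] N)]
    have h0 : (0 : R →ₗ[R] R).lcomp R N = 0 := LinearMap.ext fun f ↦ f.comp_zero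
    rw [h0]
  rw [Sum.forall, Sum.forall, Bool.forall_bool, memBass, forall_pos_iff_forall_succ,
    forall_pos_iff_forall_succ]
  refine and_assoc.symm.trans (and_congr (and_congr ?_ ?_) ?_)
  · exact forall_congr' fun j ↦ S.extVanishes_iff N j
  · exact forall_congr' fun j ↦ S.torVanishes_homModule_iff N j
  · rw [Function.Bijective, and_comm, epsMap_surjective_iff, epsMap_injective_iff, h]
    rfl

end SyzygySequence

/-- The modules `N` such that `Hom(-, N)` preserves exactness of a set of short complexes of
finitely generated modules form a preenveloping class. -/
lemma preenveloping_of_shortComplex (R : Type u) [CommRing R] [IsNoetherianRing R] {ι : Type}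
    (T : ι → ShortComplex (ModuleCat.{u} R)) (hT : ∀ i, Module.Finite R (T i).X₂) :
    Preenveloping R {N | ∀ i, Function.Exact ((T i).g.hom.lcomp R N) ((T i).f.hom.lcomp R N)} := by
  let φ (i : ι) : Limits.cokernel (T i).f ⟶ (T i).X₃ :=
    Limits.cokernel.desc (T i).f (T i).g (T i).zero
  have hφ : ∀ ⦃A B : ModuleCat.{u} R⦄ (k : A ⟶ B), MorphismProperty.ofHoms φ k →
      Module.FinitePresentation R A := by
    rintro A B k ⟨i⟩
    have := hT i
    have : Module.Finite R (Limits.cokernel (T i).f : ModuleCat.{u} R) :=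
      Module.Finite.of_surjective (Limits.cokernel.π (T i).f).hom
        ((ModuleCat.epi_iff_surjective _).1 inferInstance)
    exact Module.finitePresentation_of_finite R _
  have : MorphismProperty.IsSmall.{u} (MorphismProperty.ofHoms φ) :=
    MorphismProperty.isSmall_ofHoms.{u} φ
  convert preenveloping_of_isSmall R (MorphismProperty.ofHoms φ) hφ using 1
  ext N
  refine ⟨fun h A B k hk f ↦ ?_, fun h i x ↦ ⟨fun hx ↦ ?_, ?_⟩⟩
  · obtain ⟨i⟩ := hk
    obtain ⟨g, hg⟩ := (h i (Limits.cokernel.π (T i).f ≫ f).hom).1 (by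
      rw [LinearMap.lcomp_apply', ← ModuleCat.hom_comp, Limits.cokernel.condition_assoc,
        Limits.zero_comp, ModuleCat.hom_zero])
    refine ⟨ModuleCat.ofHom g, ?_⟩
    rw [← cancel_epi (Limits.cokernel.π (T i).f), Limits.cokernel.π_desc_assoc]
    exact ModuleCat.hom_ext hg
  · obtain ⟨g, hg⟩ := h (φ i) ⟨i⟩ (Limits.cokernel.desc _ (ModuleCat.ofHom x)
      (ModuleCat.hom_ext hx))
    refine ⟨g.hom, ?_⟩
    have := congrArg (Limits.cokernel.π (T i).f ≫ ·) hg
    simp only [φ, Limits.cokernel.π_desc_assoc, Limits.cokernel.π_desc] at this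
    exact congrArg ModuleCat.Hom.hom this
  · rintro ⟨g, rfl⟩
    exact congrArg ModuleCat.Hom.hom
      (((T i).zero_assoc (ModuleCat.ofHom g)).trans Limits.zero_comp)

/-- Of the defining properties of a semidualizing module, only finite generation is used. -/
lemma preenveloping_bassClass_of_finite {R : Type u} [CommRing R] [IsNoetherianRing R]
    (M : ModuleCat.{u} R) [Module.Finite R M] : Preenveloping R (bassClass R M) := by
  obtain ⟨S, rfl, hfin⟩ := SyzygySequence.exists_of_finite M
  have (j : ℕ) : Module.Finite R (S.P j) := (hfin j).2
  have hS : bassClass R (S.K 0) = {N : ModuleCat.{u} R | ∀ i,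
      Function.Exact ((S.bassComplex i).g.hom.lcomp R N)
        ((S.bassComplex i).f.hom.lcomp R N)} :=
    Set.ext fun N ↦ S.memBass_iff N
  rw [hS]
  exact preenveloping_of_shortComplex R S.bassComplex S.finite_bassComplex_X₂

/-- **Theorem B**: if `C` is a semidualizing module over a commutative noetherian ring `R`,
then the Bass class `B_C` is preenveloping: every `R`-module has a `B_C`-preenvelope. -/
theorem bassClass_preenveloping
    (R : Type u) [CommRing R] [IsNoetherianRing R]
    (C : Type u) [AddCommGroup C] [Module R C] (hC : IsSemidualizing R C) :
    Preenveloping R (bassClass R C) := by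
  have : Module.Finite R (ModuleCat.of R C) := hC.1
  exact preenveloping_bassClass_of_finite (ModuleCat.of R C)
end

section
/- Let C be a semidualizing module over a commutative noetherian ring R. Then the Auslander class A_C is a Kaplansky class; in fact, every infinite cardinal λ with λ ≥ |R| witnesses the Kaplansky property: for every module M ∈ A_C and every x ∈ M there is a submodule M' ⊆ M with x ∈ M', |M'| ≤ λ, M' ∈ A_C and M/M' ∈ A_C. -/
/-!
Common definitions: Ext/Tor vanishing, semidualizing modules, the Auslander and Bass
classes, (pre)covers and (pre)envelopes, cotorsion pairs, the classes `I_C` and `F_C`,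
purity, and Kaplansky classes.
-/

open CategoryTheory

universe u

open TensorProduct

@[simp]
theorem etaMap_apply_apply {R : Type u} [CommRing R] (C : Type u) [AddCommGroup C] [Module R C]
    {M : Type u} [AddCommGroup M] [Module R M] (m : M) (c : C) : etaMap R C M m c = c ⊗ₜ m :=
  rfl

theorem exists_tmul_sum {R X M : Type u} [CommRing R] [AddCommGroup X] [Module R X]
    [AddCommGroup M] [Module R M] {n : ℕ} {c : Fin n → X}
    (hc : Submodule.span R (Set.range c) = ⊤) (t : X ⊗[R] M) :
    ∃ m : Fin n → M, t = ∑ k, c k ⊗ₜ m k := by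
  induction t with
  | zero => exact ⟨0, by simp⟩
  | tmul x m =>
    obtain ⟨a, rfl⟩ := (Submodule.mem_span_range_iff_exists_fun R).1
      (hc ▸ Submodule.mem_top : x ∈ Submodule.span R (Set.range c))
    exact ⟨fun k => a k • m, by simp [TensorProduct.sum_tmul, TensorProduct.smul_tmul]⟩
  | add s t hs ht =>
    obtain ⟨m, rfl⟩ := hs
    obtain ⟨m', rfl⟩ := ht
    exact ⟨m + m', by simp [TensorProduct.tmul_add, Finset.sum_add_distrib]⟩

/-- A linear map `p : M → N` lifts solutions if every solution in `N` of a finite homogeneous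
linear system over `R` is the image under `p` of a solution in `M`. When `p` is surjective this
says that `ker p` is a pure submodule of `M`. -/
def LiftsSolutions {R M N : Type u} [CommRing R] [AddCommGroup M] [Module R M]
    [AddCommGroup N] [Module R N] (p : M →ₗ[R] N) : Prop :=
  ∀ (ι κ : Type) [Finite ι] [Fintype κ] (r : ι → κ → R) (y : κ → N),
    (∀ i, ∑ j, r i j • y j = 0) →
      ∃ x : κ → M, (∀ i, ∑ j, r i j • x j = 0) ∧ ∀ j, p (x j) = y j

namespace LiftsSolutions

variable {R A M N : Type u} [CommRing R] [AddCommGroup A] [Module R A]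
  [AddCommGroup M] [Module R M] [AddCommGroup N] [Module R N]
  {i : A →ₗ[R] M} {p : M →ₗ[R] N}

theorem exists_lift [IsNoetherianRing R] (hp : LiftsSolutions p) {X : Type u} [AddCommGroup X]
    [Module R X] [Module.Finite R X] (g : X →ₗ[R] N) : ∃ f : X →ₗ[R] M, p ∘ₗ f = g := by
  obtain ⟨n, φ, hφ⟩ := Module.Finite.exists_fin' R X
  obtain ⟨k, r, hr⟩ := Submodule.fg_iff_exists_fin_generating_family.1
    (IsNoetherian.noetherian (LinearMap.ker φ))
  have hrk (a : Fin k) : φ (r a) = 0 :=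
    LinearMap.mem_ker.1 (hr ▸ Submodule.subset_span ⟨a, rfl⟩)
  have key {P : Type u} [AddCommGroup P] [Module R P] (h : (Fin n → R) →ₗ[R] P) (v : Fin n → R) :
      h v = ∑ j, v j • h (Pi.single j 1) := by
    conv_lhs => rw [pi_eq_sum_univ' v]
    simp [map_sum]
  obtain ⟨x, hx, hxy⟩ := hp (Fin k) (Fin n) r (fun j => g (φ (Pi.single j 1))) fun a => by
    simpa [hrk] using (key (g ∘ₗ φ) (r a)).symm
  let h : (Fin n → R) →ₗ[R] M := Fintype.linearCombination R x
  have hker : LinearMap.ker φ ≤ LinearMap.ker h := by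
    rw [← hr, Submodule.span_le]
    rintro _ ⟨a, rfl⟩
    simpa [h, Fintype.linearCombination_apply] using hx a
  refine ⟨(LinearMap.ker φ).liftQ h hker ∘ₗ (φ.quotKerEquivOfSurjective hφ).symm.toLinearMap, ?_⟩
  refine (LinearMap.cancel_right hφ).1 (LinearMap.ext fun v => ?_)
  have : (φ.quotKerEquivOfSurjective hφ).symm (φ v) = (LinearMap.ker φ).mkQ v := by
    rw [LinearEquiv.symm_apply_eq]; rfl
  simp only [LinearMap.comp_apply, LinearEquiv.coe_coe, this, Submodule.mkQ_apply,
    Submodule.liftQ_apply]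
  rw [← LinearMap.comp_apply p, ← LinearMap.comp_apply g, key (p ∘ₗ h), key (g ∘ₗ φ)]
  simp [h, hxy]

theorem lTensor_injective (hp : LiftsSolutions p) (hi : Function.Injective i)
    (hip : Function.Exact i p) (X : Type u) [AddCommGroup X] [Module R X] [Module.Finite R X] :
    Function.Injective (i.lTensor X) := by
  obtain ⟨n, c, hc⟩ := Module.Finite.exists_fin (R := R) (M := X)
  refine (injective_iff_map_eq_zero _).2 fun t ht => ?_
  obtain ⟨a, rfl⟩ := exists_tmul_sum hc t
  simp only [map_sum, LinearMap.lTensor_tmul] at ht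
  obtain ⟨k, s, y, hy, hs⟩ := TensorProduct.vanishesTrivially_of_sum_tmul_eq_zero R hc ht
  obtain ⟨x, hx, hxy⟩ := hp (Fin n) (Fin k) s (fun j => p (y j)) fun l => by
    simpa [hip.apply_apply_eq_zero] using (congrArg p (hy l)).symm
  choose b hb using fun j => (hip (y j - x j)).1 (by simp [hxy])
  refine TensorProduct.sum_tmul_eq_zero_of_vanishesTrivially R ⟨k, s, b, fun l => hi ?_, hs⟩
  simp [hb, smul_sub, Finset.sum_sub_distrib, hx, hy]

/-- Tensoring with a finitely generated module preserves maps that lift solutions. -/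
theorem lTensor (hp : LiftsSolutions p)
    (X : Type u) [AddCommGroup X] [Module R X] [Module.Finite R X] :
    LiftsSolutions (p.lTensor X) := by
  classical
  intro ι κ _ _ r y hy
  have := Fintype.ofFinite ι
  obtain ⟨n, c, hc⟩ := Module.Finite.exists_fin (R := R) (M := X)
  choose m hm using fun j => exists_tmul_sum hc (y j)
  have hz (a : ι) : ∑ k, c k ⊗ₜ[R] (∑ j, r a j • m j k) = 0 := by
    rw [← hy a]
    simp only [hm, Finset.smul_sum, TensorProduct.tmul_sum, TensorProduct.tmul_smul]
    exact Finset.sum_comm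
  choose l s z hsz hs using fun a =>
    TensorProduct.vanishesTrivially_of_sum_tmul_eq_zero R hc (hz a)
  obtain ⟨x, hx, hxy⟩ := hp (ι × Fin n) ((κ × Fin n) ⊕ (Σ a, Fin (l a)))
    (fun ak => Sum.elim (fun jk => if jk.2 = ak.2 then r ak.1 jk.1 else 0)
      (fun q => if h : q.1 = ak.1 then - s ak.1 ak.2 (h ▸ q.2) else 0))
    (Sum.elim (fun jk => m jk.1 jk.2) (fun q => z q.1 q.2)) fun ⟨a, k⟩ => by
      simp [Fintype.sum_sum_type, Fintype.sum_prod_type, Fintype.sum_sigma, hsz]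
  refine ⟨fun j => ∑ k, c k ⊗ₜ x (.inl (j, k)), fun a => ?_, fun j => ?_⟩
  · have hxa (k : Fin n) : ∑ j, r a j • x (.inl (j, k)) = ∑ q, s a k q • x (.inr ⟨a, q⟩) := by
      have := hx (a, k)
      simp only [Fintype.sum_sum_type, Fintype.sum_prod_type, Fintype.sum_sigma] at this
      exact add_neg_eq_zero.1 (by simpa using this)
    simp only [Finset.smul_sum, ← TensorProduct.tmul_smul]
    rw [Finset.sum_comm]
    simp only [← TensorProduct.tmul_sum, hxa]
    exact TensorProduct.sum_tmul_eq_zero_of_vanishesTrivially R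
      ⟨_, s a, fun q => x (.inr ⟨a, q⟩), fun _ => rfl, hs a⟩
  · simp [hxy, hm]

theorem etaMap_injective (hp : LiftsSolutions p) (C : Type u) [AddCommGroup C] [Module R C]
    [Module.Finite R C] (h : Function.Injective (etaMap R C M)) :
    Function.Injective (etaMap R C N) := by
  classical
  obtain ⟨n, c, hc⟩ := Module.Finite.exists_fin (R := R) (M := C)
  refine (injective_iff_map_eq_zero _).2 fun b hb => ?_
  have hz (a : Fin n) : ∑ k, c k ⊗ₜ[R] (if k = a then b else 0) = 0 := by
    simpa [TensorProduct.tmul_ite] using LinearMap.congr_fun hb (c a)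
  choose l s z hsz hs using fun a =>
    TensorProduct.vanishesTrivially_of_sum_tmul_eq_zero R hc (hz a)
  obtain ⟨x, hx, hxy⟩ := hp (Fin n × Fin n) (Unit ⊕ (Σ a, Fin (l a)))
    (fun ak => Sum.elim (fun _ => if ak.2 = ak.1 then 1 else 0)
      (fun q => if h : q.1 = ak.1 then - s ak.1 ak.2 (h ▸ q.2) else 0))
    (Sum.elim (fun _ => b) (fun q => z q.1 q.2)) fun ⟨a, k⟩ => by
      simp [Fintype.sum_sum_type, Fintype.sum_sigma, ← hsz]
  have hxa (a k : Fin n) :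
      (if k = a then x (.inl ()) else 0) = ∑ q, s a k q • x (.inr ⟨a, q⟩) := by
    have := hx (a, k)
    simp only [Fintype.sum_sum_type, Fintype.sum_sigma] at this
    exact add_neg_eq_zero.1 (by simpa using this)
  have hx0 : x (.inl ()) = 0 := by
    refine (injective_iff_map_eq_zero _).1 h _ (LinearMap.ext_on_range hc fun a => ?_)
    have := TensorProduct.sum_tmul_eq_zero_of_vanishesTrivially R
      ⟨_, s a, fun q => x (.inr ⟨a, q⟩), hxa a, hs a⟩
    simpa [TensorProduct.tmul_ite] using this
  simpa [hx0] using (hxy (.inl ())).symm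

end LiftsSolutions

section

open Cardinal

variable (R : Type u)

/-- The language with a function symbol for each coordinate of a solution `y` of a finite linear
system `s y = r b` over `R`, taking the parameters `b` as its arguments. -/
def solverLanguage : FirstOrder.Language.{u, 0} where
  Functions n := Σ k l : ℕ, (Fin k → Fin n → R) × (Fin k → Fin l → R) × Fin l
  Relations _ := Empty

theorem card_solverLanguage_functions_le {lam : Cardinal.{u}} (hlam : ℵ₀ ≤ lam) (hR : #R ≤ lam) :
    #(Σ n, (solverLanguage R).Functions n) ≤ lam := by
  have hfin (k l : ℕ) : #(Fin k → Fin l → R) ≤ lam := by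
    have hl : #(Fin l → R) ≤ lam := by
      simpa using (power_nat_le_max (c := #R) (n := l)).trans (max_le hR hlam)
    simpa using (power_nat_le_max (c := #(Fin l → R)) (n := k)).trans (max_le hl hlam)
  have hsum {f : ℕ → Type u} (hf : ∀ n, #(f n) ≤ lam) : #(Σ n, f n) ≤ lam := by
    rw [mk_sigma]
    refine (sum_le_lift_mk_mul_iSup _).trans ?_
    refine mul_le_of_le hlam (by simpa using hlam) (ciSup_le' hf)
  refine hsum fun n => hsum fun k => hsum fun l => ?_
  rw [mk_prod, mk_prod]
  refine mul_le_of_le hlam (by simpa using hfin k n) ?_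
  simp only [lift_mul, lift_lift]
  refine mul_le_of_le hlam (by simpa using hfin k l) ?_
  simpa using (natCast_lt_aleph0.le.trans hlam : ((l : ℕ) : Cardinal.{u}) ≤ lam)

open Classical in
/-- An `R`-module interprets the symbols of `solverLanguage R` by chosen solutions, and by `0`
when the system has none. -/
noncomputable instance solverStructure [CommRing R] (M : Type u) [AddCommGroup M] [Module R M] :
    (solverLanguage R).Structure M where
  funMap f b :=
    if h : ∃ y : Fin f.2.1 → M, ∀ i, ∑ j, f.2.2.2.1 i j • y j = ∑ j, f.2.2.1 i j • b j then
      h.choose f.2.2.2.2 else 0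
  RelMap r := r.elim

theorem exists_small_liftsSolutions_mkQ [CommRing R] {M : Type u} [AddCommGroup M] [Module R M]
    {lam : Cardinal.{u}} (hlam : ℵ₀ ≤ lam) (hR : #R ≤ lam) (x : M) :
    ∃ A : Submodule R M, x ∈ A ∧ #A ≤ lam ∧ LiftsSolutions A.mkQ := by
  let S := FirstOrder.Language.Substructure.closure (solverLanguage R) {x}
  have hS {n k l : ℕ} (r : Fin k → Fin n → R) (s : Fin k → Fin l → R) (b : Fin n → M)
      (hb : ∀ i, b i ∈ S) (h : ∃ y : Fin l → M, ∀ i, ∑ j, s i j • y j = ∑ j, r i j • b j) :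
      ∃ y : Fin l → M, (∀ i, ∑ j, s i j • y j = ∑ j, r i j • b j) ∧ ∀ j, y j ∈ S := by
    refine ⟨h.choose, h.choose_spec, fun q => ?_⟩
    let f : (solverLanguage R).Functions n := ⟨k, l, r, s, q⟩
    have hf : FirstOrder.Language.Structure.funMap f b = h.choose q :=
      dif_pos (t := fun h : ∃ y : Fin l → M, _ => h.choose q) h
    exact hf ▸ S.fun_mem f b hb
  let A : Submodule R M :=
    { carrier := S
      zero_mem' := by
        obtain ⟨y, h, hy⟩ := hS (n := 0) (k := 1) (l := 1) 0 (fun _ _ => 1) 0 nofun ⟨0, by simp⟩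
        simpa [show y 0 = 0 by simpa using h 0] using hy 0
      add_mem' := fun {a b} ha hb => by
        obtain ⟨y, h, hy⟩ := hS (n := 2) (k := 1) (l := 1) (fun _ _ => 1) (fun _ _ => 1) ![a, b]
          (by simpa [Fin.forall_fin_two] using ⟨ha, hb⟩) ⟨fun _ => a + b, by simp⟩
        have : y 0 = a + b := by simpa using h 0
        simpa [this] using hy 0
      smul_mem' := fun t a ha => by
        obtain ⟨y, h, hy⟩ := hS (n := 1) (k := 1) (l := 1) (fun _ _ => t) (fun _ _ => 1) ![a]
          (by simpa using ha) ⟨fun _ => t • a, by simp⟩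
        have : y 0 = t • a := by simpa using h 0
        simpa [this] using hy 0 }
  have hmem (a : M) : a ∈ A ↔ a ∈ S := Iff.rfl
  refine ⟨A, FirstOrder.Language.Substructure.subset_closure (Set.mem_singleton x), ?_, ?_⟩
  · have := FirstOrder.Language.Substructure.lift_card_closure_le (L := solverLanguage R) (s := {x})
    simp only [lift_id] at this
    refine this.trans (max_le hlam (add_le_of_le hlam ?_
      (card_solverLanguage_functions_le R hlam hR)))
    simpa using one_le_aleph0.trans hlam
  · intro ι κ _ _ r y hy
    obtain ⟨k, ⟨e⟩⟩ := Finite.exists_equiv_fin ι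
    let e' := Fintype.equivFin κ
    choose m hm using fun j => A.mkQ_surjective (y j)
    have hb (i : ι) : ∑ j, r i j • m j ∈ A := by
      rw [← A.ker_mkQ, LinearMap.mem_ker]
      simp [hm, hy, -Submodule.mkQ_apply]
    obtain ⟨a, ha, haS⟩ := hS (fun i j => if i = j then 1 else 0)
      (fun i j => r (e.symm i) (e'.symm j)) (fun i => ∑ j, r (e.symm i) j • m j)
      (fun i => hb _) ⟨fun j => m (e'.symm j), fun i => by
        simpa using e'.symm.sum_comp (fun j => r (e.symm i) j • m j)⟩
    refine ⟨fun j => m j - a (e' j), fun i => ?_, fun j => ?_⟩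
    · have := ha (e i)
      rw [← e'.sum_comp] at this
      simpa [smul_sub, sub_eq_zero] using this.symm
    · have h0 : A.mkQ (a (e' j)) = 0 := by
        rw [← LinearMap.mem_ker, A.ker_mkQ]; exact haS _
      rw [map_sub, hm, h0, sub_zero]

end

section

variable {R : Type u} [CommRing R]

theorem extVanishes_succ_iff (X N : ModuleCat.{u} R) (n : ℕ) :
    extVanishes R X N (n + 1) ↔ Subsingleton (Abelian.Ext.{u} X N (n + 1)) := by
  let P := projectiveResolution X
  have h₁ : extVanishes R X N (n + 1) ↔
      ∀ f : P.complex.X (n + 1) ⟶ N, P.complex.d (n + 2) (n + 1) ≫ f = 0 →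
        ∃ g : P.complex.X n ⟶ N, P.complex.d (n + 1) n ≫ g = f := by
    unfold extVanishes
    rw [← ModuleCat.isZero_iff_subsingleton, (P.isoExt (R := R) (n + 1) N).isZero_iff,
      ← HomologicalComplex.exactAt_iff_isZero_homology,
      HomologicalComplex.exactAt_iff' _ n (n + 1) (n + 2) (by simp) (by simp),
      ShortComplex.moduleCat_exact_iff]
    rfl
  rw [h₁]
  refine ⟨fun h => subsingleton_of_forall_eq 0 fun α => ?_, fun _ f hf => ?_⟩
  · obtain ⟨f, hf, rfl⟩ := P.extMk_surjective α (n + 2) rfl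
    exact (P.extMk_eq_zero_iff f (n + 2) rfl hf n rfl).2 (h f hf)
  · exact (P.extMk_eq_zero_iff f (n + 2) rfl hf n rfl).1 (Subsingleton.elim _ _)

variable {K F X N : Type u} [AddCommGroup K] [Module R K] [AddCommGroup F] [Module R F]
  [AddCommGroup X] [Module R X] [AddCommGroup N] [Module R N]
  {k : K →ₗ[R] F} {q : F →ₗ[R] X}

theorem shortExact_of_linearMap (hk : Function.Injective k) (hkq : Function.Exact k q)
    (hq : Function.Surjective q) :
    (ShortComplex.mk (ModuleCat.ofHom k) (ModuleCat.ofHom q)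
      (by ext x; exact hkq.apply_apply_eq_zero x)).ShortExact where
  exact := by
    rw [ShortComplex.ShortExact.moduleCat_exact_iff_function_exact]; exact hkq
  mono_f := (ModuleCat.mono_iff_injective _).2 hk
  epi_g := (ModuleCat.epi_iff_surjective _).2 hq

theorem extVanishes_one_iff [Module.Projective R F] (hk : Function.Injective k)
    (hkq : Function.Exact k q) (hq : Function.Surjective q) :
    extVanishes R (ModuleCat.of R X) (ModuleCat.of R N) 1 ↔
      ∀ f : K →ₗ[R] N, ∃ g : F →ₗ[R] N, g ∘ₗ k = f := by
  rw [extVanishes_succ_iff]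
  have hS := shortExact_of_linearMap hk hkq hq
  have : Projective (ModuleCat.of R F) := inferInstance
  refine ⟨fun _ f => ?_, fun h => subsingleton_of_forall_eq 0 fun α => ?_⟩
  · obtain ⟨β, hβ⟩ := Abelian.Ext.contravariant_sequence_exact₁ hS (ModuleCat.of R N)
      (Abelian.Ext.mk₀ (ModuleCat.ofHom f)) (add_zero 1) (Subsingleton.elim _ _)
    obtain ⟨g, rfl⟩ := (Abelian.Ext.mk₀_bijective _ _).surjective β
    rw [Abelian.Ext.mk₀_comp_mk₀] at hβ
    exact ⟨g.hom, congrArg ModuleCat.Hom.hom ((Abelian.Ext.mk₀_bijective _ _).injective hβ)⟩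
  · obtain ⟨β, rfl⟩ := Abelian.Ext.contravariant_sequence_exact₃ hS (ModuleCat.of R N) α
      (Abelian.Ext.eq_zero_of_projective (P := ModuleCat.of R F) _) (add_zero 1)
    obtain ⟨f, rfl⟩ := (Abelian.Ext.mk₀_bijective _ _).surjective β
    obtain ⟨g, hg⟩ := h f.hom
    have : f = ModuleCat.ofHom k ≫ ModuleCat.ofHom g := by
      ext x; exact (LinearMap.congr_fun hg x).symm
    rw [this, ← Abelian.Ext.mk₀_comp_mk₀]
    exact hS.extClass_comp_assoc _

theorem extVanishes_succ_succ_iff [Module.Projective R F] (hk : Function.Injective k)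
    (hkq : Function.Exact k q) (hq : Function.Surjective q) (n : ℕ) :
    extVanishes R (ModuleCat.of R X) (ModuleCat.of R N) (n + 2) ↔
      extVanishes R (ModuleCat.of R K) (ModuleCat.of R N) (n + 1) := by
  rw [extVanishes_succ_iff, extVanishes_succ_iff]
  have hS := shortExact_of_linearMap hk hkq hq
  have : Projective (ModuleCat.of R F) := inferInstance
  refine ⟨fun _ => subsingleton_of_forall_eq 0 fun α => ?_,
    fun _ => subsingleton_of_forall_eq 0 fun α => ?_⟩
  · obtain ⟨β, rfl⟩ := Abelian.Ext.contravariant_sequence_exact₁ hS (ModuleCat.of R N)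
      α (by lia : 1 + (n + 1) = n + 2) (Subsingleton.elim _ _)
    rw [Abelian.Ext.eq_zero_of_projective (P := ModuleCat.of R F) β, Abelian.Ext.comp_zero]
  · obtain ⟨β, rfl⟩ := Abelian.Ext.contravariant_sequence_exact₃ hS (ModuleCat.of R N) α
      (Abelian.Ext.eq_zero_of_projective (P := ModuleCat.of R F) _) (by lia : 1 + (n + 1) = n + 2)
    rw [Subsingleton.elim β 0, Abelian.Ext.comp_zero]

end

section

variable {R : Type u} [CommRing R]

section Syzygy

variable {M : ModuleCat.{u} R} (P : ProjectiveResolution M)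

/-- The `n`-th syzygy of `M` in the projective resolution `P`. -/
noncomputable def syzygy : ℕ → ModuleCat.{u} R
  | 0 => M
  | n + 1 => ModuleCat.of R (LinearMap.range (P.complex.d (n + 1) n).hom)

/-- The inclusion of the `(n + 1)`-st syzygy into the `n`-th term of the resolution. -/
noncomputable def syzygyInclusion (n : ℕ) : syzygy P (n + 1) →ₗ[R] P.complex.X n :=
  (LinearMap.range (P.complex.d (n + 1) n).hom).subtype

/-- The projection of the `n`-th term of the resolution onto the `n`-th syzygy. -/
noncomputable def syzygyProjection : (n : ℕ) → P.complex.X n →ₗ[R] syzygy P n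
  | 0 => (P.π.f 0).hom
  | n + 1 => (P.complex.d (n + 1) n).hom.rangeRestrict

theorem syzygyInclusion_injective (n : ℕ) : Function.Injective (syzygyInclusion P n) :=
  Submodule.subtype_injective _

theorem syzygyProjection_surjective : (n : ℕ) → Function.Surjective (syzygyProjection P n)
  | 0 => (ModuleCat.epi_iff_surjective (P.π.f 0)).1 inferInstance
  | _ + 1 => LinearMap.surjective_rangeRestrict _

theorem resolution_d_exact (n : ℕ) :
    Function.Exact (P.complex.d (n + 2) (n + 1)).hom (P.complex.d (n + 1) n).hom :=
  (ShortComplex.ShortExact.moduleCat_exact_iff_function_exact _).1 (P.exact_succ n)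

theorem syzygy_exact : (n : ℕ) → Function.Exact (syzygyInclusion P n) (syzygyProjection P n)
  | 0 => LinearMap.exact_iff.2 <|
    (LinearMap.exact_iff.1 ((ShortComplex.ShortExact.moduleCat_exact_iff_function_exact _).1
      P.exact₀)).trans (Submodule.range_subtype _).symm
  | n + 1 => LinearMap.exact_iff.2 <|
    ((LinearMap.ker_rangeRestrict _).trans (resolution_d_exact P n).linearMap_ker_eq).trans
      (Submodule.range_subtype _).symm

theorem torVanishes_succ_iff (X : ModuleCat.{u} R) (n : ℕ) :
    torVanishes R X M (n + 1) ↔ Function.Injective ((syzygyInclusion P n).lTensor X) := by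
  have h₁ : torVanishes R X M (n + 1) ↔ Function.Exact
      ((P.complex.d (n + 2) (n + 1)).hom.lTensor X) ((P.complex.d (n + 1) n).hom.lTensor X) := by
    unfold torVanishes
    rw [← ModuleCat.isZero_iff_subsingleton]
    refine (P.isoLeftDerivedObj ((MonoidalCategory.tensoringLeft _).obj X)
      (n + 1)).isZero_iff.trans ?_
    refine (HomologicalComplex.exactAt_iff_isZero_homology _ _).symm.trans ?_
    rw [HomologicalComplex.exactAt_iff' _ (n + 2) (n + 1) n (by simp) (by simp)]
    exact ShortComplex.ShortExact.moduleCat_exact_iff_function_exact _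
  have h₂ : Function.Exact ((P.complex.d (n + 2) (n + 1)).hom.lTensor X)
      ((syzygyProjection P (n + 1)).lTensor X) :=
    lTensor_exact X (LinearMap.exact_iff.2
      ((LinearMap.ker_rangeRestrict _).trans (resolution_d_exact P n).linearMap_ker_eq))
      (syzygyProjection_surjective P (n + 1))
  have h₃ : (P.complex.d (n + 1) n).hom.lTensor X =
      (syzygyInclusion P n).lTensor X ∘ₗ (syzygyProjection P (n + 1)).lTensor X := by
    rw [← LinearMap.lTensor_comp]; rfl
  rw [h₁, h₃]
  refine ⟨fun h => (injective_iff_map_eq_zero _).2 fun t ht => ?_, fun h => ?_⟩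
  · obtain ⟨s, rfl⟩ := LinearMap.lTensor_surjective X (syzygyProjection_surjective P (n + 1)) t
    obtain ⟨v, rfl⟩ := (h s).1 ht
    exact h₂.apply_apply_eq_zero v
  · rw [LinearMap.exact_iff, LinearMap.ker_comp, LinearMap.ker_eq_bot.2 h,
      ← LinearMap.exact_iff.1 h₂]
    rfl

end Syzygy

section Grid

variable {K F X L Q M : Type u} [AddCommGroup K] [Module R K] [AddCommGroup F] [Module R F]
  [AddCommGroup X] [Module R X] [AddCommGroup L] [Module R L] [AddCommGroup Q] [Module R Q]
  [AddCommGroup M] [Module R M]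
  {k : K →ₗ[R] F} {q : F →ₗ[R] X} {l : L →ₗ[R] Q} {p : Q →ₗ[R] M}

theorem lTensor_injective_of_rTensor_injective [Module.Flat R F] (hkq : Function.Exact k q)
    (hq : Function.Surjective q) (hl : Function.Injective l) (hlp : Function.Exact l p)
    (hp : Function.Surjective p) (h : Function.Injective (k.rTensor M)) :
    Function.Injective (l.lTensor X) := by
  refine (injective_iff_map_eq_zero _).2 fun t ht => ?_
  obtain ⟨f, rfl⟩ := LinearMap.rTensor_surjective L hq t
  have h₁ : q.rTensor Q (l.lTensor F f) = 0 := by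
    rw [← ht, ← LinearMap.comp_apply, ← LinearMap.comp_apply,
      LinearMap.rTensor_comp_lTensor, LinearMap.lTensor_comp_rTensor]
  obtain ⟨s, hs⟩ := (rTensor_exact Q hkq hq _).1 h₁
  have h₂ : k.rTensor M (p.lTensor K s) = 0 := by
    rw [← LinearMap.comp_apply, LinearMap.rTensor_comp_lTensor, ← LinearMap.lTensor_comp_rTensor,
      LinearMap.comp_apply, hs]
    exact (lTensor_exact F hlp hp).apply_apply_eq_zero f
  obtain ⟨v, rfl⟩ := (lTensor_exact K hlp hp _).1 ((injective_iff_map_eq_zero _).1 h _ h₂)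
  have h₃ : k.rTensor L v = f := by
    refine Module.Flat.lTensor_preserves_injective_linearMap l hl ?_
    rw [← hs, ← LinearMap.comp_apply, ← LinearMap.comp_apply,
      LinearMap.rTensor_comp_lTensor, LinearMap.lTensor_comp_rTensor]
  rw [← h₃]
  exact (rTensor_exact L hkq hq).apply_apply_eq_zero v

theorem lTensor_injective_iff_rTensor_injective [Module.Flat R F] [Module.Flat R Q]
    (hk : Function.Injective k) (hkq : Function.Exact k q) (hq : Function.Surjective q)
    (hl : Function.Injective l) (hlp : Function.Exact l p) (hp : Function.Surjective p) :
    Function.Injective (l.lTensor X) ↔ Function.Injective (k.rTensor M) := by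
  refine ⟨fun h => ?_, lTensor_injective_of_rTensor_injective hkq hq hl hlp hp⟩
  rw [← LinearMap.lTensor_inj_iff_rTensor_inj]
  exact lTensor_injective_of_rTensor_injective hlp hp hk hkq hq
    ((LinearMap.lTensor_inj_iff_rTensor_inj ..).1 h)

theorem rTensor_injective_iff_lTensor_injective [Module.Flat R F] [Module.Flat R Q]
    (hk : Function.Injective k) (hl : Function.Injective l) :
    Function.Injective (k.rTensor L) ↔ Function.Injective (l.lTensor K) := by
  rw [← (Module.Flat.lTensor_preserves_injective_linearMap (M := F) l hl).of_comp_iff,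
    ← (Module.Flat.rTensor_preserves_injective_linearMap (M := Q) k hk).of_comp_iff (l.lTensor K),
    ← LinearMap.coe_comp, ← LinearMap.coe_comp, LinearMap.rTensor_comp_lTensor,
    LinearMap.lTensor_comp_rTensor]

theorem torVanishes_one_iff [Module.Flat R F] (hk : Function.Injective k)
    (hkq : Function.Exact k q) (hq : Function.Surjective q) :
    torVanishes R (ModuleCat.of R X) (ModuleCat.of R M) 1 ↔
      Function.Injective (k.rTensor M) := by
  let P := projectiveResolution (ModuleCat.of R M)
  have (n : ℕ) : Module.Projective R (P.complex.X n) :=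
    (IsProjective.iff_projective (P.complex.X n)).2 (P.projective n)
  exact (torVanishes_succ_iff P _ 0).trans (lTensor_injective_iff_rTensor_injective hk hkq hq
    (syzygyInclusion_injective P 0) (syzygy_exact P 0) (syzygyProjection_surjective P 0))

theorem torVanishes_succ_succ_iff [Module.Flat R F] (hk : Function.Injective k)
    (hkq : Function.Exact k q) (hq : Function.Surjective q) (n : ℕ) :
    torVanishes R (ModuleCat.of R X) (ModuleCat.of R M) (n + 2) ↔
      torVanishes R (ModuleCat.of R K) (ModuleCat.of R M) (n + 1) := by
  let P := projectiveResolution (ModuleCat.of R M)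
  have (n : ℕ) : Module.Projective R (P.complex.X n) :=
    (IsProjective.iff_projective (P.complex.X n)).2 (P.projective n)
  exact (torVanishes_succ_iff P _ (n + 1)).trans <|
    (lTensor_injective_iff_rTensor_injective hk hkq hq (syzygyInclusion_injective P (n + 1))
      (syzygy_exact P (n + 1)) (syzygyProjection_surjective P (n + 1))).trans <|
    (rTensor_injective_iff_lTensor_injective hk (syzygyInclusion_injective P n)).trans
      (torVanishes_succ_iff P (ModuleCat.of R K) n).symm

end Grid

end

namespace LiftsSolutions

variable {R A M N : Type u} [CommRing R] [IsNoetherianRing R] [AddCommGroup A] [Module R A]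
  [AddCommGroup M] [Module R M] [AddCommGroup N] [Module R N]
  {i : A →ₗ[R] M} {p : M →ₗ[R] N}

theorem torVanishes_left (hp : LiftsSolutions p) (hi : Function.Injective i)
    (hip : Function.Exact i p) (n : ℕ) (X : Type u) [AddCommGroup X] [Module R X]
    [Module.Finite R X] (h : torVanishes R (ModuleCat.of R X) (ModuleCat.of R M) (n + 1)) :
    torVanishes R (ModuleCat.of R X) (ModuleCat.of R A) (n + 1) := by
  induction n generalizing X with
  | zero =>
    obtain ⟨m, φ, hφ⟩ := Module.Finite.exists_fin' R X
    have hK := Submodule.subtype_injective (LinearMap.ker φ)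
    have hex := LinearMap.exact_subtype_ker_map φ
    rw [torVanishes_one_iff hK hex hφ] at h ⊢
    have hc := h.comp (hp.lTensor_injective hi hip (LinearMap.ker φ))
    rw [← LinearMap.coe_comp, LinearMap.rTensor_comp_lTensor,
      ← LinearMap.lTensor_comp_rTensor, LinearMap.coe_comp] at hc
    exact hc.of_comp
  | succ n ih =>
    obtain ⟨m, φ, hφ⟩ := Module.Finite.exists_fin' R X
    have hK := Submodule.subtype_injective (LinearMap.ker φ)
    have hex := LinearMap.exact_subtype_ker_map φ
    rw [torVanishes_succ_succ_iff hK hex hφ] at h ⊢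
    exact ih _ h

theorem torVanishes_right (hp : LiftsSolutions p) (hi : Function.Injective i)
    (hip : Function.Exact i p) (hps : Function.Surjective p) (n : ℕ) (X : Type u)
    [AddCommGroup X] [Module R X] [Module.Finite R X]
    (h : torVanishes R (ModuleCat.of R X) (ModuleCat.of R M) (n + 1)) :
    torVanishes R (ModuleCat.of R X) (ModuleCat.of R N) (n + 1) := by
  induction n generalizing X with
  | zero =>
    obtain ⟨m, φ, hφ⟩ := Module.Finite.exists_fin' R X
    have hK := Submodule.subtype_injective (LinearMap.ker φ)
    have hex := LinearMap.exact_subtype_ker_map φ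
    rw [torVanishes_one_iff hK hex hφ] at h ⊢
    refine (injective_iff_map_eq_zero _).2 fun t ht => ?_
    obtain ⟨s, rfl⟩ := LinearMap.lTensor_surjective (LinearMap.ker φ) hps t
    rw [← LinearMap.comp_apply, LinearMap.rTensor_comp_lTensor,
      ← LinearMap.lTensor_comp_rTensor, LinearMap.comp_apply] at ht
    obtain ⟨y, hy⟩ := (lTensor_exact (Fin m → R) hip hps _).1 ht
    have hy₀ : φ.rTensor A y = 0 := by
      refine hp.lTensor_injective hi hip X ?_
      rw [← LinearMap.comp_apply, LinearMap.lTensor_comp_rTensor,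
        ← LinearMap.rTensor_comp_lTensor, LinearMap.comp_apply, hy, map_zero]
      exact (rTensor_exact M hex hφ).apply_apply_eq_zero s
    obtain ⟨z, rfl⟩ := (rTensor_exact A hex hφ y).1 hy₀
    have hz : i.lTensor (LinearMap.ker φ) z = s := by
      refine h ?_
      rw [← hy, ← LinearMap.comp_apply, ← LinearMap.comp_apply,
        LinearMap.rTensor_comp_lTensor, LinearMap.lTensor_comp_rTensor]
    rw [← hz]
    exact (lTensor_exact (LinearMap.ker φ) hip hps).apply_apply_eq_zero z
  | succ n ih =>
    obtain ⟨m, φ, hφ⟩ := Module.Finite.exists_fin' R X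
    have hK := Submodule.subtype_injective (LinearMap.ker φ)
    have hex := LinearMap.exact_subtype_ker_map φ
    rw [torVanishes_succ_succ_iff hK hex hφ] at h ⊢
    exact ih _ h

theorem extVanishes_left (hp : LiftsSolutions p) (hi : Function.Injective i)
    (hip : Function.Exact i p) (n : ℕ) (X : Type u) [AddCommGroup X] [Module R X]
    [Module.Finite R X] (h : extVanishes R (ModuleCat.of R X) (ModuleCat.of R M) (n + 1)) :
    extVanishes R (ModuleCat.of R X) (ModuleCat.of R A) (n + 1) := by
  induction n generalizing X with
  | zero =>
    obtain ⟨m, φ, hφ⟩ := Module.Finite.exists_fin' R X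
    have hK := Submodule.subtype_injective (LinearMap.ker φ)
    have hex := LinearMap.exact_subtype_ker_map φ
    rw [extVanishes_one_iff hK hex hφ] at h ⊢
    intro f
    obtain ⟨g, hg⟩ := h (i ∘ₗ f)
    have hgK : LinearMap.ker φ ≤ LinearMap.ker (p ∘ₗ g) := fun v hv => by
      have := LinearMap.congr_fun hg ⟨v, hv⟩
      simp only [LinearMap.comp_apply, Submodule.subtype_apply] at this
      simp [this, hip.apply_apply_eq_zero]
    obtain ⟨b, hb⟩ := hp.exists_lift ((LinearMap.ker φ).liftQ (p ∘ₗ g) hgK ∘ₗ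
      (φ.quotKerEquivOfSurjective hφ).symm.toLinearMap)
    have hb' (v) : p (b (φ v)) = p (g v) := by
      have hv : (φ.quotKerEquivOfSurjective hφ).symm (φ v) = (LinearMap.ker φ).mkQ v := by
        rw [LinearEquiv.symm_apply_eq]; rfl
      simpa [hv] using LinearMap.congr_fun hb (φ v)
    have hr (v) : (g - b ∘ₗ φ) v ∈ LinearMap.range i :=
      (hip _).1 (by simp [hb'])
    let e := LinearEquiv.ofInjective i hi
    refine ⟨e.symm.toLinearMap ∘ₗ (g - b ∘ₗ φ).codRestrict _ hr, LinearMap.ext fun v => ?_⟩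
    refine (LinearEquiv.symm_apply_eq e).2 (Subtype.ext ?_)
    have := LinearMap.congr_fun hg v
    simp only [LinearMap.comp_apply, Submodule.subtype_apply] at this
    simp [e, this, LinearMap.mem_ker.1 v.2]
  | succ n ih =>
    obtain ⟨m, φ, hφ⟩ := Module.Finite.exists_fin' R X
    have hK := Submodule.subtype_injective (LinearMap.ker φ)
    have hex := LinearMap.exact_subtype_ker_map φ
    rw [extVanishes_succ_succ_iff hK hex hφ] at h ⊢
    exact ih _ h

theorem extVanishes_right (hp : LiftsSolutions p) (n : ℕ) (X : Type u) [AddCommGroup X]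
    [Module R X] [Module.Finite R X]
    (h : extVanishes R (ModuleCat.of R X) (ModuleCat.of R M) (n + 1)) :
    extVanishes R (ModuleCat.of R X) (ModuleCat.of R N) (n + 1) := by
  induction n generalizing X with
  | zero =>
    obtain ⟨m, φ, hφ⟩ := Module.Finite.exists_fin' R X
    have hK := Submodule.subtype_injective (LinearMap.ker φ)
    have hex := LinearMap.exact_subtype_ker_map φ
    rw [extVanishes_one_iff hK hex hφ] at h ⊢
    intro f
    obtain ⟨f, rfl⟩ := hp.exists_lift f
    obtain ⟨g, rfl⟩ := h f
    exact ⟨p ∘ₗ g, rfl⟩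
  | succ n ih =>
    obtain ⟨m, φ, hφ⟩ := Module.Finite.exists_fin' R X
    have hK := Submodule.subtype_injective (LinearMap.ker φ)
    have hex := LinearMap.exact_subtype_ker_map φ
    rw [extVanishes_succ_succ_iff hK hex hφ] at h ⊢
    exact ih _ h

variable (C : Type u) [AddCommGroup C] [Module R C] [Module.Finite R C]

theorem memAuslander_left (hp : LiftsSolutions p) (hi : Function.Injective i)
    (hip : Function.Exact i p) (hps : Function.Surjective p)
    (h : memAuslander R C (ModuleCat.of R M)) : memAuslander R C (ModuleCat.of R A) := by
  obtain ⟨hTor, hExt, hη⟩ := h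
  have hCi := hp.lTensor_injective hi hip C
  have hC : Function.Exact (i.lTensor C) (p.lTensor C) := lTensor_exact C hip hps
  refine ⟨fun j hj => ?_, fun j hj => ?_, fun a b hab => ?_, fun f => ?_⟩
  · obtain ⟨n, rfl⟩ := Nat.exists_eq_add_one.2 hj
    exact hp.torVanishes_left hi hip n C (hTor _ hj)
  · obtain ⟨n, rfl⟩ := Nat.exists_eq_add_one.2 hj
    exact (hp.lTensor C).extVanishes_left hCi hC n C (hExt _ hj)
  · refine hi (hη.1 (LinearMap.ext fun c => ?_))
    exact congrArg (i.lTensor C) (LinearMap.congr_fun hab c)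
  · obtain ⟨m, hm⟩ := hη.2 (i.lTensor C ∘ₗ f)
    have hpm : p m = 0 := by
      refine (injective_iff_map_eq_zero _).1 (hp.etaMap_injective C hη.1) _
        (LinearMap.ext fun c => ?_)
      have := congrArg (p.lTensor C) (LinearMap.congr_fun hm c)
      exact this.trans (hC.apply_apply_eq_zero _)
    obtain ⟨a, rfl⟩ := (hip m).1 hpm
    exact ⟨a, LinearMap.ext fun c => hCi (LinearMap.congr_fun hm c)⟩

theorem memAuslander_right (hp : LiftsSolutions p) (hi : Function.Injective i)
    (hip : Function.Exact i p) (hps : Function.Surjective p)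
    (h : memAuslander R C (ModuleCat.of R M)) : memAuslander R C (ModuleCat.of R N) := by
  obtain ⟨hTor, hExt, hη⟩ := h
  refine ⟨fun j hj => ?_, fun j hj => ?_, hp.etaMap_injective C hη.1, fun g => ?_⟩
  · obtain ⟨n, rfl⟩ := Nat.exists_eq_add_one.2 hj
    exact hp.torVanishes_right hi hip hps n C (hTor _ hj)
  · obtain ⟨n, rfl⟩ := Nat.exists_eq_add_one.2 hj
    exact (hp.lTensor C).extVanishes_right n C (hExt _ hj)
  · obtain ⟨f, rfl⟩ := (hp.lTensor C).exists_lift g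
    obtain ⟨m, rfl⟩ := hη.2 f
    exact ⟨p m, rfl⟩

end LiftsSolutions

/-- If `C` is a semidualizing module over a commutative noetherian ring `R`, then the
Auslander class `A_C` is a Kaplansky class; in fact every infinite cardinal `λ ≥ |R|`
witnesses the Kaplansky property. -/
theorem auslanderClass_kaplansky
    (R : Type u) [CommRing R] [IsNoetherianRing R]
    (C : Type u) [AddCommGroup C] [Module R C] (hC : IsSemidualizing R C) :
    KaplanskyClass R (auslanderClass R C) ∧
    ∀ lam : Cardinal.{u}, Cardinal.aleph0 ≤ lam → Cardinal.mk R ≤ lam →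
      ∀ M ∈ auslanderClass R C, ∀ x : M, ∃ M' : Submodule R M,
        x ∈ M' ∧ Cardinal.mk M' ≤ lam ∧
        ModuleCat.of R M' ∈ auslanderClass R C ∧
        ModuleCat.of R (M ⧸ M') ∈ auslanderClass R C := by
  have hfin : Module.Finite R C := hC.1
  have key (lam : Cardinal.{u}) (hlam : Cardinal.aleph0 ≤ lam) (hR : Cardinal.mk R ≤ lam)
      (M : ModuleCat.{u} R) (hM : M ∈ auslanderClass R C) (x : M) :
      ∃ M' : Submodule R M, x ∈ M' ∧ Cardinal.mk M' ≤ lam ∧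
        ModuleCat.of R M' ∈ auslanderClass R C ∧
        ModuleCat.of R (M ⧸ M') ∈ auslanderClass R C := by
    obtain ⟨A, hxA, hA, hp⟩ := exists_small_liftsSolutions_mkQ R hlam hR x
    have hex := LinearMap.exact_subtype_mkQ A
    exact ⟨A, hxA, hA,
      hp.memAuslander_left C A.subtype_injective hex A.mkQ_surjective hM,
      hp.memAuslander_right C A.subtype_injective hex A.mkQ_surjective hM⟩
  exact ⟨⟨max Cardinal.aleph0 (Cardinal.mk R), key _ (le_max_left _ _) (le_max_right _ _)⟩, key⟩
end

section
/- Let C be a semidualizing module over a commutative noetherian ring R. Then the Bass class B_C is a Kaplansky class; in fact, every infinite cardinal λ with λ ≥ |R| witnesses the Kaplansky property: for every module N ∈ B_C and every x ∈ N there is a submodule N' ⊆ N with x ∈ N', |N'| ≤ λ, N' ∈ B_C and N/N' ∈ B_C. -/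
/-!
Common definitions: Ext/Tor vanishing, semidualizing modules, the Auslander and Bass
classes, (pre)covers and (pre)envelopes, cotorsion pairs, the classes `I_C` and `F_C`,
purity, and Kaplansky classes.
-/

open CategoryTheory

universe u

/-- A submodule `S` of `N` is solution-closed if every finite linear system with constants
in `S` that is solvable in `N` is solvable in `S`: a linear map `x : Rⁿ → N` (a tuple of unknowns)
that maps a submodule `W` (of equations) into `S` agrees on `W` with a linear map into `S`. -/
def IsSolutionClosed {R : Type u} [CommRing R] {N : Type u} [AddCommGroup N] [Module R N]
    (S : Submodule R N) : Prop :=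
  ∀ (n : ℕ) (W : Submodule R (Fin n → R)) (x : (Fin n → R) →ₗ[R] N), W ≤ S.comap x →
    ∃ y : (Fin n → R) →ₗ[R] S, ∀ w ∈ W, (y w : N) = x w

section SolutionLanguage

open Cardinal

/-- The language whose `m`-ary function symbols stand for the values at given vectors of chosen
solutions of linear systems with `m` equations. -/
def linearSystemLanguage (R : Type u) : FirstOrder.Language.{u, 0} where
  Functions m := Σ n : ℕ, (Fin m → Fin n → R) × (Fin n → R)
  Relations _ := Empty

lemma mk_linearSystemLanguage_functions_le (R : Type u) (lam : Cardinal.{u}) (h₀ : ℵ₀ ≤ lam)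
    (hR : #R ≤ lam) : #(Σ m, (linearSystemLanguage R).Functions m) ≤ lam := by
  have hpow (n : ℕ) : #(Fin n → R) ≤ lam := by
    simpa using (power_le_power_right hR).trans (power_nat_le (n := n) h₀)
  have hpow₂ (m n : ℕ) : #(Fin m → Fin n → R) ≤ lam := by
    simpa using (power_le_power_right (hpow n)).trans (power_nat_le (n := m) h₀)
  have hsum (f : ℕ → Type u) (hf : ∀ n, #(f n) ≤ lam) : #(Σ n, f n) ≤ lam := by
    rw [mk_sigma]
    refine (sum_le_lift_mk_mul_iSup _).trans ?_
    refine mul_le_of_le h₀ (by simpa using h₀) (ciSup_le' hf)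
  refine hsum _ fun m => hsum _ fun n => ?_
  rw [mk_prod, lift_id, lift_id]
  exact mul_le_of_le h₀ (hpow₂ m n) (hpow n)

variable (R : Type u) [CommRing R] (N : Type u) [AddCommGroup N] [Module R N]

/-- A linear map `Rⁿ → N` with prescribed values on a finite family of vectors, if there is one. -/
noncomputable def linearSystemSolution {m n : ℕ} (A : Fin m → Fin n → R) (s : Fin m → N) :
    (Fin n → R) →ₗ[R] N :=
  open scoped Classical in
  if h : ∃ x : (Fin n → R) →ₗ[R] N, ∀ i, x (A i) = s i then h.choose else 0

variable {R N} in
lemma linearSystemSolution_apply {m n : ℕ} (A : Fin m → Fin n → R) (s : Fin m → N)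
    (x : (Fin n → R) →ₗ[R] N) (hx : ∀ i, x (A i) = s i) (i : Fin m) :
    linearSystemSolution R N A s (A i) = s i := by
  have h : ∃ x : (Fin n → R) →ₗ[R] N, ∀ i, x (A i) = s i := ⟨x, hx⟩
  rw [linearSystemSolution, dif_pos h]
  exact h.choose_spec i

/-- Interpretation of `linearSystemLanguage R` in an `R`-module. -/
noncomputable abbrev linearSystemStructure : (linearSystemLanguage R).Structure N where
  funMap f s := linearSystemSolution R N f.2.1 s f.2.2
  RelMap r _ := r.elim

theorem exists_isSolutionClosed [IsNoetherianRing R] (lam : Cardinal.{u}) (h₀ : ℵ₀ ≤ lam)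
    (hR : #R ≤ lam) (x : N) :
    ∃ S : Submodule R N, x ∈ S ∧ #S ≤ lam ∧ IsSolutionClosed S := by
  let := linearSystemStructure R N
  let T := FirstOrder.Language.Substructure.closure (linearSystemLanguage R) ({x} : Set N)
  have hT {m n : ℕ} (A : Fin m → Fin n → R) (s : Fin m → N) (hs : ∀ i, s i ∈ T)
      (v : Fin n → R) : linearSystemSolution R N A s v ∈ T :=
    T.fun_mem (⟨n, A, v⟩ : (linearSystemLanguage R).Functions m) s hs
  let S : Submodule R N :=
    { carrier := T
      zero_mem' := by
        have := hT (n := 0) (Fin.elim0 : Fin 0 → Fin 0 → R) Fin.elim0 (fun i => i.elim0) 0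
        rwa [map_zero] at this
      add_mem' := by
        intro a b ha hb
        have h := linearSystemSolution_apply (R := R) (Pi.basisFun R (Fin 2)) ![a, b]
          ((Pi.basisFun R (Fin 2)).constr R ![a, b]) (by simp)
        have := hT (Pi.basisFun R (Fin 2)) ![a, b] (Fin.forall_fin_two.mpr ⟨ha, hb⟩)
          (Pi.basisFun R (Fin 2) 0 + Pi.basisFun R (Fin 2) 1)
        rw [map_add, h, h] at this
        simpa using this
      smul_mem' := by
        intro r a ha
        have h := linearSystemSolution_apply (R := R) (Pi.basisFun R (Fin 1)) ![a]
          ((Pi.basisFun R (Fin 1)).constr R ![a]) (by simp)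
        have := hT (Pi.basisFun R (Fin 1)) ![a] (Fin.forall_fin_one.mpr ha)
          (r • Pi.basisFun R (Fin 1) 0)
        rw [map_smul, h] at this
        simpa using this }
  refine ⟨S, FirstOrder.Language.Substructure.subset_closure (L := linearSystemLanguage R) rfl,
    ?_, ?_⟩
  · have h := FirstOrder.Language.Substructure.lift_card_closure_le
      (L := linearSystemLanguage R) (s := ({x} : Set N))
    rw [lift_id, lift_id, lift_id, mk_singleton] at h
    refine h.trans (max_le h₀ (add_le_of_le h₀ (one_le_aleph0.trans h₀) ?_))
    exact mk_linearSystemLanguage_functions_le R lam h₀ hR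
  · intro n W x hW
    obtain ⟨m, A, hA⟩ := Submodule.fg_iff_exists_fin_generating_family.mp
      (IsNoetherian.noetherian W)
    have hAW (i : Fin m) : A i ∈ W := hA ▸ Submodule.subset_span ⟨i, rfl⟩
    refine ⟨(linearSystemSolution R N A (fun i => x (A i))).codRestrict S
      (fun v => hT A _ (fun i => hW (hAW i)) v), fun w hw => ?_⟩
    rw [← hA] at hw
    exact LinearMap.eqOn_span
      (f := linearSystemSolution R N A fun i => x (A i)) (g := x)
      (by rintro _ ⟨i, rfl⟩; exact linearSystemSolution_apply A _ x (fun _ => rfl) i) hw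

end SolutionLanguage

namespace IsSolutionClosed

variable {R : Type u} [CommRing R] {N : Type u} [AddCommGroup N] [Module R N] {S : Submodule R N}

/-- If the composite of `φ : P → S` with the inclusion factors through `g : P → Q`, with `Q`
finitely generated, then so does `φ`. -/
theorem exists_factorization (hS : IsSolutionClosed S) {P Q : Type*} [AddCommGroup P] [Module R P]
    [AddCommGroup Q] [Module R Q] [Module.Finite R Q] (g : P →ₗ[R] Q) (φ : P →ₗ[R] S)
    (ψ : Q →ₗ[R] N) (h : ∀ p, (φ p : N) = ψ (g p)) : ∃ ψ' : Q →ₗ[R] S, ψ' ∘ₗ g = φ := by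
  obtain ⟨n, π, hπ⟩ := Module.Finite.exists_fin' R Q
  obtain ⟨y, hy⟩ := hS n ((LinearMap.range g).comap π) (ψ ∘ₗ π) (by
    rintro w ⟨p, hp⟩
    simp [← hp, ← h])
  have hker : LinearMap.ker π ≤ LinearMap.ker y := fun w hw => by
    have := hy w (by simp [LinearMap.mem_ker.mp hw])
    simpa [LinearMap.mem_ker.mp hw] using this
  refine ⟨(LinearMap.ker π).liftQ y hker ∘ₗ (π.quotKerEquivOfSurjective hπ).symm.toLinearMap, ?_⟩
  ext p
  obtain ⟨w, hw⟩ := hπ (g p)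
  have hw' : (π.quotKerEquivOfSurjective hπ).symm (g p) = Submodule.Quotient.mk w := by
    rw [LinearEquiv.symm_apply_eq, ← hw]; rfl
  have := hy w ⟨p, hw.symm⟩
  simp [hw', this, h, hw]

/-- A linear map from a finitely generated module to the quotient by a solution-closed submodule
lifts. -/
theorem exists_lift (hS : IsSolutionClosed S) {P : Type*} [AddCommGroup P] [Module R P]
    [Module.Finite R P] (φ : P →ₗ[R] N ⧸ S) : ∃ ψ : P →ₗ[R] N, S.mkQ ∘ₗ ψ = φ := by
  obtain ⟨n, π, hπ⟩ := Module.Finite.exists_fin' R P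
  obtain ⟨x, hx⟩ := Module.projective_lifting_property S.mkQ (φ ∘ₗ π) S.mkQ_surjective
  have hx' (w) : S.mkQ (x w) = φ (π w) := LinearMap.congr_fun hx w
  obtain ⟨y, hy⟩ := hS n (LinearMap.ker π) x fun w hw => by
    have := hx' w
    rw [LinearMap.mem_ker.mp hw, map_zero, Submodule.mkQ_apply,
      Submodule.Quotient.mk_eq_zero] at this
    exact this
  refine ⟨(LinearMap.ker π).liftQ (x - S.subtype ∘ₗ y) (fun w hw => by simp [hy w hw]) ∘ₗ
    (π.quotKerEquivOfSurjective hπ).symm.toLinearMap, ?_⟩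
  ext p
  obtain ⟨w, rfl⟩ := hπ p
  have hw' : (π.quotKerEquivOfSurjective hπ).symm (π w) = Submodule.Quotient.mk w := by
    rw [LinearEquiv.symm_apply_eq]; rfl
  simpa [hw', (Submodule.Quotient.mk_eq_zero S).mpr (y w).2] using hx' w

open TensorProduct in
/-- Tensoring `Hom(C, S) → Hom(C, N)` with a finitely generated module keeps it injective, for
finitely generated `C` and solution-closed `S`. -/
theorem lTensor_compRight_subtype_injective (hS : IsSolutionClosed S) (C K : Type u)
    [AddCommGroup C] [Module R C] [Module.Finite R C]
    [AddCommGroup K] [Module R K] [Module.Finite R K] :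
    Function.Injective (LinearMap.lTensor K (S.subtype.compRight R : (C →ₗ[R] S) →ₗ[R] _)) := by
  obtain ⟨n, k, hk⟩ := Module.Finite.exists_fin (R := R) (M := K)
  have key (z : K ⊗[R] (C →ₗ[R] S)) : ∃ f : Fin n → (C →ₗ[R] S), z = ∑ i, k i ⊗ₜ f i := by
    induction z with
    | zero => exact ⟨0, by simp⟩
    | tmul a f =>
      obtain ⟨c, rfl⟩ := (Submodule.mem_span_range_iff_exists_fun R).mp
        (hk ▸ Submodule.mem_top : a ∈ Submodule.span R (Set.range k))
      exact ⟨fun i => c i • f, by simp [sum_tmul, smul_tmul]⟩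
    | add a b ha hb =>
      obtain ⟨f, rfl⟩ := ha
      obtain ⟨g, rfl⟩ := hb
      exact ⟨f + g, by simp [tmul_add, Finset.sum_add_distrib]⟩
  rw [injective_iff_map_eq_zero]
  intro z hz
  obtain ⟨f, rfl⟩ := key z
  simp only [map_sum, LinearMap.lTensor_tmul] at hz
  obtain ⟨m, a, y, h₁, h₂⟩ := vanishesTrivially_of_sum_tmul_eq_zero R hk hz
  obtain ⟨ψ, hψ⟩ := hS.exists_factorization
    (LinearMap.pi fun j => ∑ i, a i j • LinearMap.proj i : (Fin n → C) →ₗ[R] (Fin m → C))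
    (∑ i, f i ∘ₗ LinearMap.proj i) (∑ j, y j ∘ₗ LinearMap.proj j) (by
      intro p
      have h₁' (i : Fin n) (c : C) : (f i c : N) = ∑ j, a i j • y j c := by
        simpa using LinearMap.congr_fun (h₁ i) c
      simp only [LinearMap.sum_apply, LinearMap.comp_apply, LinearMap.proj_apply,
        LinearMap.pi_apply, LinearMap.smul_apply, map_sum, map_smul,
        AddSubmonoidClass.coe_finsetSum, h₁']
      exact Finset.sum_comm)
  refine sum_tmul_eq_zero_of_vanishesTrivially R
    ⟨m, a, fun j => ψ ∘ₗ LinearMap.single R (fun _ => C) j, fun i => ?_, h₂⟩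
  refine LinearMap.ext fun c => ?_
  have h := LinearMap.congr_fun hψ (Pi.single i c)
  simp only [LinearMap.comp_apply, LinearMap.sum_apply, LinearMap.proj_apply] at h
  rw [Finset.sum_eq_single i (by intro l _ hl; simp [Pi.single_eq_of_ne hl]) (by simp),
    Pi.single_eq_same] at h
  rw [← h, LinearMap.sum_apply]
  simp only [LinearMap.smul_apply, LinearMap.comp_apply, ← map_smul, ← map_sum]
  congr 1
  ext j
  simp [Pi.single_apply]

end IsSolutionClosed

section SyzygyExchange

variable {R : Type u} [CommRing R]

/-- Diagram chase in a map of short exact sequences of complexes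
`K → F → C`, in degrees `3, 2, 1` and `0`, where `F` is exact in degrees `1` and `2`. -/
lemma exact_iff_of_exact_middle {K₂ K₁ F₃ F₂ F₁ F₀ C₃ C₂ C₁ : Type*}
    [AddCommGroup K₂] [AddCommGroup K₁] [AddCommGroup F₃] [AddCommGroup F₂] [AddCommGroup F₁]
    [AddCommGroup F₀] [AddCommGroup C₃] [AddCommGroup C₂] [AddCommGroup C₁]
    [Module R K₂] [Module R K₁] [Module R F₃] [Module R F₂] [Module R F₁]
    [Module R F₀] [Module R C₃] [Module R C₂] [Module R C₁]
    {k₂ : K₂ →ₗ[R] K₁}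
    {f₃ : F₃ →ₗ[R] F₂} {f₂ : F₂ →ₗ[R] F₁} {f₁ : F₁ →ₗ[R] F₀}
    {c₃ : C₃ →ₗ[R] C₂} {c₂ : C₂ →ₗ[R] C₁}
    {i₂ : K₂ →ₗ[R] F₂} {i₁ : K₁ →ₗ[R] F₁}
    {p₃ : F₃ →ₗ[R] C₃} {p₂ : F₂ →ₗ[R] C₂} {p₁ : F₁ →ₗ[R] C₁}
    (hi : ∀ x, i₁ (k₂ x) = f₂ (i₂ x))
    (hp₃ : ∀ x, p₂ (f₃ x) = c₃ (p₃ x)) (hp₂ : ∀ x, p₁ (f₂ x) = c₂ (p₂ x))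
    (hi₁ : Function.Injective i₁) (e₁ : Function.Exact i₁ p₁)
    (e₂ : Function.Exact i₂ p₂) (hp₂s : Function.Surjective p₂) (hp₃s : Function.Surjective p₃)
    (hf₂ : Function.Exact f₃ f₂) (hf₁ : Function.Exact f₂ f₁) :
    Function.Exact c₃ c₂ ↔ ∀ k, f₁ (i₁ k) = 0 → ∃ l, k₂ l = k := by
  constructor
  · intro h k hk
    obtain ⟨f, hf⟩ := (hf₁ _).mp hk
    obtain ⟨x, hx⟩ := (h (p₂ f)).mp (by rw [← hp₂, hf, e₁.apply_apply_eq_zero])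
    obtain ⟨g, rfl⟩ := hp₃s x
    obtain ⟨l, hl⟩ := (e₂ (f - f₃ g)).mp (by rw [map_sub, hp₃, hx, sub_self])
    exact ⟨l, hi₁ (by rw [hi, hl, map_sub, hf, hf₂.apply_apply_eq_zero, sub_zero])⟩
  · intro h x
    constructor
    · intro hx
      obtain ⟨f, rfl⟩ := hp₂s x
      obtain ⟨k, hk⟩ := (e₁ (f₂ f)).mp (by rw [hp₂, hx])
      obtain ⟨l, rfl⟩ := h k (by rw [hk, hf₁.apply_apply_eq_zero])
      obtain ⟨g, hg⟩ := (hf₂ (f - i₂ l)).mp (by rw [map_sub, ← hi, hk, sub_self])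
      exact ⟨p₃ g, by rw [← hp₃, hg, map_sub, e₂.apply_apply_eq_zero, sub_zero]⟩
    · rintro ⟨y, rfl⟩
      obtain ⟨g, rfl⟩ := hp₃s y
      rw [← hp₃, ← hp₂, hf₂.apply_apply_eq_zero, map_zero]

end SyzygyExchange

section Tor

open LinearMap

variable {R : Type u} [CommRing R]

lemma lTensor_rTensor_apply {A B M N : Type*} [AddCommGroup A] [AddCommGroup B]
    [AddCommGroup M] [AddCommGroup N] [Module R A] [Module R B] [Module R M] [Module R N]
    (f : A →ₗ[R] B) (g : M →ₗ[R] N) (x : TensorProduct R A M) :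
    lTensor B g (rTensor M f x) = rTensor N f (lTensor A g x) :=
  LinearMap.congr_fun
    ((lTensor_comp_rTensor (f := f) (g := g)).trans (rTensor_comp_lTensor (f := f) (g := g)).symm) x

lemma torVanishes_succ_iff_s4 (C M : ModuleCat.{u} R) (Q : ProjectiveResolution M) (j : ℕ) :
    torVanishes R C M (j + 1) ↔
      Function.Exact (lTensor C (Q.complex.d (j + 2) (j + 1)).hom)
        (lTensor C (Q.complex.d (j + 1) j).hom) := by
  let e := Q.isoLeftDerivedObj ((MonoidalCategory.tensoringLeft (ModuleCat.{u} R)).obj C) (j + 1)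
  rw [torVanishes, ← ModuleCat.isZero_iff_subsingleton]
  refine e.isZero_iff.trans ((HomologicalComplex.exactAt_iff_isZero_homology _ _).symm.trans ?_)
  rw [HomologicalComplex.exactAt_iff' _ (j + 2) (j + 1) j (by simp) (by simp),
    ShortComplex.ShortExact.moduleCat_exact_iff_function_exact]
  rfl

instance (M : ModuleCat.{u} R) (Q : ProjectiveResolution M) (j : ℕ) :
    Module.Flat R (Q.complex.X j) :=
  have := (IsProjective.iff_projective (R := R) (Q.complex.X j)).mpr (Q.projective j)
  inferInstance

lemma exact_d (M : ModuleCat.{u} R) (Q : ProjectiveResolution M) (j : ℕ) :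
    Function.Exact (Q.complex.d (j + 2) (j + 1)).hom (Q.complex.d (j + 1) j).hom :=
  (ShortComplex.ShortExact.moduleCat_exact_iff_function_exact _).mp (Q.exact_succ j)

variable {K F C : Type u} [AddCommGroup K] [AddCommGroup F] [AddCommGroup C]
  [Module R K] [Module R F] [Module R C] [Module.Flat R F]
  {i : K →ₗ[R] F} {p : F →ₗ[R] C}

lemma torVanishes_succ_succ_iff_s4 (hi : Function.Injective i) (hip : Function.Exact i p)
    (hp : Function.Surjective p) (M : ModuleCat.{u} R) (j : ℕ) :
    torVanishes R (ModuleCat.of R C) M (j + 2) ↔ torVanishes R (ModuleCat.of R K) M (j + 1) := by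
  let Q := projectiveResolution M
  rw [torVanishes_succ_iff_s4 _ M Q, torVanishes_succ_iff_s4 _ M Q]
  rw [exact_iff_of_exact_middle (i₂ := rTensor _ i) (i₁ := rTensor _ i)
    (k₂ := lTensor K (Q.complex.d (j + 2) (j + 1)).hom)
    (f₃ := lTensor F (Q.complex.d (j + 3) (j + 2)).hom)
    (f₂ := lTensor F (Q.complex.d (j + 2) (j + 1)).hom)
    (f₁ := lTensor F (Q.complex.d (j + 1) j).hom)
    (p₃ := rTensor _ p) (p₂ := rTensor _ p) (p₁ := rTensor _ p)
    (fun x => (lTensor_rTensor_apply _ _ x).symm) (fun x => (lTensor_rTensor_apply _ _ x).symm)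
    (fun x => (lTensor_rTensor_apply _ _ x).symm)
    (Module.Flat.rTensor_preserves_injective_linearMap _ hi)
    (rTensor_exact _ hip hp) (rTensor_exact _ hip hp)
    (rTensor_surjective _ hp) (rTensor_surjective _ hp)
    (Module.Flat.lTensor_exact _ (exact_d M Q (j + 1)))
    (Module.Flat.lTensor_exact _ (exact_d M Q j))]
  have h (x) : lTensor F (Q.complex.d (j + 1) j).hom (rTensor _ i x) = 0 ↔
      lTensor K (Q.complex.d (j + 1) j).hom x = 0 := by
    rw [lTensor_rTensor_apply]
    exact map_eq_zero_iff _ (Module.Flat.rTensor_preserves_injective_linearMap _ hi)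
  refine ⟨fun H x => ⟨fun hx => H x ((h x).mpr hx), ?_⟩, fun H x hx => (H x).mp ((h x).mp hx)⟩
  rintro ⟨y, rfl⟩
  exact (lTensor_comp_apply _ _ _ y).symm.trans
    (by rw [(exact_d M Q j).linearMap_comp_eq_zero, lTensor_zero]; rfl)

lemma torVanishes_one_iff_s4 (hi : Function.Injective i) (hip : Function.Exact i p)
    (hp : Function.Surjective p) (M : ModuleCat.{u} R) :
    torVanishes R (ModuleCat.of R C) M 1 ↔ Function.Injective (rTensor M i) := by
  let Q := projectiveResolution M
  let q : Q.complex.X 0 →ₗ[R] M := (Q.π.f 0).hom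
  have hq : Function.Surjective q := (ModuleCat.epi_iff_surjective (Q.π.f 0)).mp inferInstance
  have hdq : Function.Exact (Q.complex.d 1 0).hom q :=
    (ShortComplex.ShortExact.moduleCat_exact_iff_function_exact _).mp Q.exact₀
  rw [torVanishes_succ_iff_s4 _ M Q]
  rw [exact_iff_of_exact_middle (i₂ := rTensor _ i) (i₁ := rTensor _ i)
    (k₂ := lTensor K (Q.complex.d 1 0).hom)
    (f₃ := lTensor F (Q.complex.d 2 1).hom)
    (f₂ := lTensor F (Q.complex.d 1 0).hom)
    (f₁ := lTensor F q)
    (p₃ := rTensor _ p) (p₂ := rTensor _ p) (p₁ := rTensor _ p)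
    (fun x => (lTensor_rTensor_apply _ _ x).symm) (fun x => (lTensor_rTensor_apply _ _ x).symm)
    (fun x => (lTensor_rTensor_apply _ _ x).symm)
    (Module.Flat.rTensor_preserves_injective_linearMap _ hi)
    (rTensor_exact _ hip hp) (rTensor_exact _ hip hp)
    (rTensor_surjective _ hp) (rTensor_surjective _ hp)
    (Module.Flat.lTensor_exact _ (exact_d M Q 0)) (Module.Flat.lTensor_exact _ hdq)]
  have h (x) : lTensor F q (rTensor _ i x) = rTensor M i (lTensor K q x) :=
    lTensor_rTensor_apply _ _ x
  have hex := lTensor_exact K hdq hq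
  rw [injective_iff_map_eq_zero, (lTensor_surjective K hq).forall]
  exact forall_congr' fun x => by rw [h, hex x]; rfl

end Tor

section Ext

variable {R : Type u} [CommRing R]

lemma extVanishes_succ_iff_s4 (C N : ModuleCat.{u} R) (P : ProjectiveResolution C) (j : ℕ) :
    extVanishes R C N (j + 1) ↔
      ∀ φ : P.complex.X (j + 1) →ₗ[R] N, φ ∘ₗ (P.complex.d (j + 2) (j + 1)).hom = 0 →
        ∃ ψ : P.complex.X j →ₗ[R] N, ψ ∘ₗ (P.complex.d (j + 1) j).hom = φ := by
  let e := P.isoExt (R := R) (j + 1) N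
  rw [extVanishes, ← ModuleCat.isZero_iff_subsingleton]
  refine e.isZero_iff.trans ((HomologicalComplex.exactAt_iff_isZero_homology _ _).symm.trans ?_)
  rw [HomologicalComplex.exactAt_iff' _ j (j + 1) (j + 2) (by simp) (by simp),
    ShortComplex.moduleCat_exact_iff]
  constructor
  · intro h φ hφ
    obtain ⟨ψ, hψ⟩ := h (ModuleCat.ofHom φ) (ModuleCat.hom_ext hφ)
    exact ⟨ψ.hom, congr_arg ModuleCat.Hom.hom hψ⟩
  · intro h φ hφ
    obtain ⟨ψ, hψ⟩ := h φ.hom (congr_arg ModuleCat.Hom.hom hφ)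
    exact ⟨ModuleCat.ofHom ψ, ModuleCat.hom_ext hψ⟩

end Ext

section FiniteResolution

variable (R : Type u) [CommRing R]

/-- The finitely generated modules. -/
abbrev FiniteModule := {M : ModuleCat.{u} R // Module.Finite R M}

namespace FiniteModule

variable {R} (M : FiniteModule R)

instance : Module.Finite R M.1 := M.2

/-- A free module of finite rank that surjects onto `M`. -/
abbrev freeCover : ModuleCat.{u} R :=
  ModuleCat.of R (Fin (Module.Finite.exists_fin' R M.1).choose → R)

/-- A chosen surjection onto `M` from `M.freeCover`. -/
noncomputable def cover : M.freeCover →ₗ[R] M.1 :=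
  (Module.Finite.exists_fin' R M.1).choose_spec.choose

lemma cover_surjective : Function.Surjective M.cover :=
  (Module.Finite.exists_fin' R M.1).choose_spec.choose_spec

variable [IsNoetherianRing R]

/-- The kernel of the chosen surjection. -/
noncomputable abbrev kernelCover : FiniteModule R :=
  ⟨ModuleCat.of R (LinearMap.ker M.cover),
    inferInstanceAs (Module.Finite R (LinearMap.ker M.cover))⟩

/-- The iterated kernels of the chosen surjections. -/
noncomputable def syzygy (M : FiniteModule R) : ℕ → FiniteModule R
  | 0 => M
  | j + 1 => (syzygy M j).kernelCover

/-- The differential of the free resolution of `M`. -/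
noncomputable def resolutionD (j : ℕ) : (M.syzygy (j + 1)).freeCover ⟶ (M.syzygy j).freeCover :=
  ModuleCat.ofHom ((LinearMap.ker (M.syzygy j).cover).subtype ∘ₗ (M.syzygy j).kernelCover.cover)

lemma exact_subtype_comp_cover :
    Function.Exact ((LinearMap.ker M.cover).subtype ∘ₗ M.kernelCover.cover) M.cover := by
  intro x
  constructor
  · intro hx
    obtain ⟨y, hy⟩ := M.kernelCover.cover_surjective ⟨x, hx⟩
    exact ⟨y, congr_arg Subtype.val hy⟩
  · rintro ⟨y, rfl⟩
    exact (M.kernelCover.cover y).2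

lemma exact_resolutionD (j : ℕ) :
    Function.Exact (M.resolutionD (j + 1)).hom (M.resolutionD j).hom :=
  (M.syzygy (j + 1)).exact_subtype_comp_cover.comp_injective _
    (Submodule.subtype_injective (LinearMap.ker (M.syzygy j).cover)) (map_zero _)

end FiniteModule

theorem exists_projectiveResolution_finite {R : Type u} [CommRing R] [IsNoetherianRing R]
    (C : ModuleCat.{u} R) [Module.Finite R C] :
    ∃ P : ProjectiveResolution C, ∀ j, Module.Finite R (P.complex.X j) := by
  let M : FiniteModule R := ⟨C, inferInstance⟩
  let X := ChainComplex.of (fun j => (M.syzygy j).freeCover) M.resolutionD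
    (fun j => ModuleCat.hom_ext (M.exact_resolutionD j).linearMap_comp_eq_zero)
  have hd (j : ℕ) : X.d (j + 1) j = M.resolutionD j :=
    ChainComplex.of_d (fun j => (M.syzygy j).freeCover) M.resolutionD j
  let p : X.X 0 ⟶ C := ModuleCat.ofHom M.cover
  have hdp : X.d 1 0 ≫ p = 0 := by
    rw [hd]
    exact ModuleCat.hom_ext M.exact_subtype_comp_cover.linearMap_comp_eq_zero
  have hfin (j : ℕ) : Module.Finite R (X.X j) := inferInstanceAs (Module.Finite R (Fin _ → R))
  have hproj (j : ℕ) : Projective (X.X j) :=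
    (IsProjective.iff_projective (R := R) (X.X j)).mp
      (inferInstanceAs (Module.Projective R (Fin _ → R)))
  refine ⟨{ complex := X
            π := (ChainComplex.toSingle₀Equiv _ _).symm ⟨p, hdp⟩
            quasiIso := ⟨fun n => ?_⟩ }, hfin⟩
  cases n with
  | zero =>
    rw [ChainComplex.quasiIsoAt₀_iff, ShortComplex.quasiIso_iff_of_zeros']
    · refine (ShortComplex.exact_and_epi_g_iff_of_iso
        (S₂ := ShortComplex.mk (X.d 1 0) p hdp) ?_).2 ⟨?_, ?_⟩
      · exact ShortComplex.isoMk (Iso.refl _) (Iso.refl _) (Iso.refl _)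
          ((Category.id_comp _).trans (Category.comp_id _).symm)
          ((Category.id_comp _).trans (Category.comp_id _).symm)
      · rw [ShortComplex.ShortExact.moduleCat_exact_iff_function_exact]
        simp only [hd]
        exact M.exact_subtype_comp_cover
      · exact (ModuleCat.epi_iff_surjective p).mpr M.cover_surjective
    all_goals rfl
  | succ n =>
    rw [quasiIsoAt_iff_exactAt' _ _ (ChainComplex.exactAt_succ_single_obj _ _),
      HomologicalComplex.exactAt_iff' _ (n + 2) (n + 1) n (by simp) (by simp),
      ShortComplex.ShortExact.moduleCat_exact_iff_function_exact]
    have := M.exact_resolutionD n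
    rw [← hd, ← hd] at this
    exact this

end FiniteResolution

namespace IsSolutionClosed

open LinearMap

variable {R : Type u} [CommRing R] [IsNoetherianRing R] {N : Type u} [AddCommGroup N] [Module R N]
  {S : Submodule R N} (C : Type u) [AddCommGroup C] [Module R C] [Module.Finite R C]

theorem extVanishes_submodule (hS : IsSolutionClosed S) (j : ℕ)
    (h : extVanishes R (ModuleCat.of R C) (ModuleCat.of R N) (j + 1)) :
    extVanishes R (ModuleCat.of R C) (ModuleCat.of R S) (j + 1) := by
  obtain ⟨P, hP⟩ := exists_projectiveResolution_finite (ModuleCat.of R C)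
  rw [extVanishes_succ_iff_s4 _ _ P] at h ⊢
  intro φ hφ
  obtain ⟨ψ, hψ⟩ := h (S.subtype ∘ₗ φ) (LinearMap.ext fun x =>
    congr_arg Subtype.val (LinearMap.congr_fun hφ x))
  have := hP j
  exact hS.exists_factorization _ φ ψ fun p => (LinearMap.congr_fun hψ p).symm

theorem extVanishes_quotient (hS : IsSolutionClosed S) (j : ℕ)
    (h : extVanishes R (ModuleCat.of R C) (ModuleCat.of R N) (j + 1)) :
    extVanishes R (ModuleCat.of R C) (ModuleCat.of R (N ⧸ S)) (j + 1) := by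
  obtain ⟨P, hP⟩ := exists_projectiveResolution_finite (ModuleCat.of R C)
  rw [extVanishes_succ_iff_s4 _ _ P] at h ⊢
  intro (φ : P.complex.X (j + 1) →ₗ[R] N ⧸ S) hφ
  have := hP (j + 1)
  obtain ⟨φ', rfl⟩ := hS.exists_lift φ
  have hmem (x) : φ' ((P.complex.d (j + 2) (j + 1)).hom x) ∈ S :=
    (Submodule.Quotient.mk_eq_zero S).mp (LinearMap.congr_fun hφ x)
  obtain ⟨χ, hχ⟩ := hS.exists_factorization (P.complex.d (j + 2) (j + 1)).hom
    ((φ' ∘ₗ (P.complex.d (j + 2) (j + 1)).hom).codRestrict S hmem) φ' fun _ => rfl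
  obtain ⟨ψ, hψ⟩ := h (φ' - S.subtype ∘ₗ χ) (LinearMap.ext fun x =>
    sub_eq_zero.mpr (congr_arg Subtype.val (LinearMap.congr_fun hχ x)).symm)
  refine ⟨S.mkQ ∘ₗ ψ, LinearMap.ext fun x => ?_⟩
  refine (congr_arg S.mkQ (LinearMap.congr_fun hψ x)).trans ?_
  exact (map_sub S.mkQ (φ' x) (χ x)).trans
    (by simp [(Submodule.Quotient.mk_eq_zero S).mpr (χ x).2])

end IsSolutionClosed

section TorPure

open LinearMap

variable {R : Type u} [CommRing R] [IsNoetherianRing R]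
  {M' M M'' : Type u} [AddCommGroup M'] [Module R M'] [AddCommGroup M] [Module R M]
  [AddCommGroup M''] [Module R M''] {a : M' →ₗ[R] M} {b : M →ₗ[R] M''}

/-- For `0 → M' → M → M'' → 0` exact, remaining so after tensoring with finitely generated
modules, the vanishing of `Tor(K, M)` for a finitely generated module `K` is inherited by `M'`
and by `M''`. -/
theorem torVanishes_of_lTensor_injective
    (ha : ∀ (K : Type u) [AddCommGroup K] [Module R K] [Module.Finite R K],
      Function.Injective (lTensor K a))
    (hab : Function.Exact a b) (hb : Function.Surjective b) (j : ℕ)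
    (K : Type u) [AddCommGroup K] [Module R K] [Module.Finite R K]
    (h : torVanishes R (ModuleCat.of R K) (ModuleCat.of R M) (j + 1)) :
    torVanishes R (ModuleCat.of R K) (ModuleCat.of R M') (j + 1) ∧
      torVanishes R (ModuleCat.of R K) (ModuleCat.of R M'') (j + 1) := by
  induction j generalizing K with
  | zero =>
    obtain ⟨n, p, hp⟩ := Module.Finite.exists_fin' R K
    have hi := (ker p).subtype_injective
    have hip := exact_subtype_ker_map p
    rw [zero_add, torVanishes_one_iff_s4 hi hip hp] at h ⊢
    rw [torVanishes_one_iff_s4 hi hip hp]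
    constructor
    · refine Function.Injective.of_comp (f := lTensor (Fin n → R) a) fun x y hxy => ?_
      simp only [Function.comp_def, lTensor_rTensor_apply] at hxy
      exact ha _ (h hxy)
    · refine (injective_iff_map_eq_zero _).mpr fun z hz => ?_
      obtain ⟨k, rfl⟩ := lTensor_surjective _ hb z
      rw [← lTensor_rTensor_apply] at hz
      obtain ⟨f, hf⟩ := (lTensor_exact _ hab hb _).mp hz
      obtain ⟨k', rfl⟩ := (rTensor_exact M' hip hp f).mp (ha K (by
        rw [lTensor_rTensor_apply, hf, map_zero]
        exact (rTensor_exact M hip hp _).mpr ⟨k, rfl⟩))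
      rw [lTensor_rTensor_apply] at hf
      rw [← h hf]
      exact (lTensor_exact _ hab hb _).mpr ⟨k', rfl⟩
  | succ j ih =>
    obtain ⟨n, p, hp⟩ := Module.Finite.exists_fin' R K
    have hi := (ker p).subtype_injective
    have hip := exact_subtype_ker_map p
    rw [torVanishes_succ_succ_iff_s4 hi hip hp] at h ⊢
    rw [torVanishes_succ_succ_iff_s4 hi hip hp]
    exact ih _ h

end TorPure

section Evaluation

open TensorProduct

variable {R : Type u} [CommRing R] (C : Type u) [AddCommGroup C] [Module R C]
  {N L : Type u} [AddCommGroup N] [Module R N] [AddCommGroup L] [Module R L]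

lemma epsMap_lTensor_compRight (f : N →ₗ[R] L) (z : C ⊗[R] (C →ₗ[R] N)) :
    epsMap R C L (LinearMap.lTensor C (f.compRight R) z) = f (epsMap R C N z) := by
  induction z with
  | zero => simp
  | tmul c g => rfl
  | add x y hx hy => simp only [map_add, hx, hy]

lemma exact_compRight (S : Submodule R N) : Function.Exact
    (S.subtype.compRight R : (C →ₗ[R] S) →ₗ[R] _)
    (S.mkQ.compRight R : (C →ₗ[R] N) →ₗ[R] _) := by
  intro f
  constructor
  · intro hf
    exact ⟨f.codRestrict S fun c =>
      (Submodule.Quotient.mk_eq_zero S).mp (LinearMap.congr_fun hf c), rfl⟩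
  · rintro ⟨g, rfl⟩
    exact LinearMap.ext fun c => (Submodule.Quotient.mk_eq_zero S).mpr (g c).2

end Evaluation

namespace IsSolutionClosed

open TensorProduct

variable {R : Type u} [CommRing R] {N : Type u} [AddCommGroup N] [Module R N]
  {S : Submodule R N} (C : Type u) [AddCommGroup C] [Module R C] [Module.Finite R C]

theorem epsMap_submodule_surjective (hS : IsSolutionClosed S)
    (h : Function.Surjective (epsMap R C N)) : Function.Surjective (epsMap R C S) := by
  intro s
  obtain ⟨z, hz⟩ := h s
  obtain ⟨n, c, f, rfl⟩ := exists_sum_tmul_eq z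
  obtain ⟨ψ, hψ⟩ := hS.exists_factorization
    (LinearMap.toSpanSingleton R (Fin n → C) c) (LinearMap.toSpanSingleton R S s)
    (∑ i, f i ∘ₗ LinearMap.proj i) (fun r => by
      simp [← hz, epsMap])
  refine ⟨∑ i, c i ⊗ₜ (ψ ∘ₗ LinearMap.single R (fun _ => C) i), ?_⟩
  have h₁ : ψ c = s := by simpa using LinearMap.congr_fun hψ 1
  rw [map_sum, ← h₁]
  exact (map_sum ψ _ _).symm.trans (congr_arg ψ (LinearMap.sum_single_apply (fun _ => C) c))

theorem bijective_epsMap_submodule (hS : IsSolutionClosed S)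
    (h : Function.Bijective (epsMap R C N)) : Function.Bijective (epsMap R C S) := by
  refine ⟨fun x y hxy => ?_, hS.epsMap_submodule_surjective C h.2⟩
  refine hS.lTensor_compRight_subtype_injective C C (h.1 ?_)
  rw [epsMap_lTensor_compRight, epsMap_lTensor_compRight, hxy]

theorem bijective_epsMap_quotient (hS : IsSolutionClosed S)
    (h : Function.Bijective (epsMap R C N)) : Function.Bijective (epsMap R C (N ⧸ S)) := by
  constructor
  · refine (injective_iff_map_eq_zero _).mpr fun z hz => ?_
    obtain ⟨y, rfl⟩ := LinearMap.lTensor_surjective C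
      (g := (S.mkQ.compRight R : (C →ₗ[R] N) →ₗ[R] _)) hS.exists_lift z
    rw [epsMap_lTensor_compRight] at hz
    obtain ⟨x, hx⟩ := hS.epsMap_submodule_surjective C h.2
      ⟨_, (Submodule.Quotient.mk_eq_zero S).mp hz⟩
    rw [← h.1 ((epsMap_lTensor_compRight C S.subtype x).trans (congr_arg Subtype.val hx))]
    exact (lTensor_exact C (exact_compRight C S) hS.exists_lift _).mpr ⟨x, rfl⟩
  · intro n
    obtain ⟨m, rfl⟩ := S.mkQ_surjective n
    obtain ⟨z, rfl⟩ := h.2 m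
    exact ⟨_, epsMap_lTensor_compRight C S.mkQ z⟩

variable [IsNoetherianRing R]

theorem mem_bassClass (hS : IsSolutionClosed S) (h : ModuleCat.of R N ∈ bassClass R C) :
    ModuleCat.of R S ∈ bassClass R C ∧ ModuleCat.of R (N ⧸ S) ∈ bassClass R C := by
  obtain ⟨hext, htor, heps⟩ := h
  have htor' (j : ℕ) := torVanishes_of_lTensor_injective
    (a := (S.subtype.compRight R : (C →ₗ[R] S) →ₗ[R] _))
    (fun K _ _ _ => hS.lTensor_compRight_subtype_injective C K) (exact_compRight C S)
    hS.exists_lift j C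
    (htor (j + 1) j.succ_pos)
  refine ⟨⟨fun j hj => ?_, fun j hj => ?_, hS.bijective_epsMap_submodule C heps⟩,
    fun j hj => ?_, fun j hj => ?_, hS.bijective_epsMap_quotient C heps⟩ <;>
  obtain ⟨j, rfl⟩ := Nat.exists_eq_succ_of_ne_zero hj.ne'
  · exact hS.extVanishes_submodule C j (hext _ hj)
  · exact (htor' j).1
  · exact hS.extVanishes_quotient C j (hext _ hj)
  · exact (htor' j).2

end IsSolutionClosed

/-- If `C` is a semidualizing module over a commutative noetherian ring `R`, then the
Bass class `B_C` is a Kaplansky class; in fact every infinite cardinal `λ ≥ |R|`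
witnesses the Kaplansky property. -/
theorem bassClass_kaplansky
    (R : Type u) [CommRing R] [IsNoetherianRing R]
    (C : Type u) [AddCommGroup C] [Module R C] (hC : IsSemidualizing R C) :
    KaplanskyClass R (bassClass R C) ∧
    ∀ lam : Cardinal.{u}, Cardinal.aleph0 ≤ lam → Cardinal.mk R ≤ lam →
      ∀ N ∈ bassClass R C, ∀ x : N, ∃ N' : Submodule R N,
        x ∈ N' ∧ Cardinal.mk N' ≤ lam ∧
        ModuleCat.of R N' ∈ bassClass R C ∧
        ModuleCat.of R (N ⧸ N') ∈ bassClass R C := by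
  have := hC.1
  suffices h : ∀ lam : Cardinal.{u}, Cardinal.aleph0 ≤ lam → Cardinal.mk R ≤ lam →
      ∀ N ∈ bassClass R C, ∀ x : N, ∃ N' : Submodule R N,
        x ∈ N' ∧ Cardinal.mk N' ≤ lam ∧
        ModuleCat.of R N' ∈ bassClass R C ∧
        ModuleCat.of R (N ⧸ N') ∈ bassClass R C from
    ⟨⟨max Cardinal.aleph0 (Cardinal.mk R), h _ (le_max_left _ _) (le_max_right _ _)⟩, h⟩
  intro lam h₀ hR N hN x
  obtain ⟨S, hx, hcard, hS⟩ := exists_isSolutionClosed R N lam h₀ hR x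
  exact ⟨S, hx, hcard, hS.mem_bassClass C hN⟩
end

section
/- Let C be a semidualizing module over a commutative noetherian ring R. The class I_C is closed under pure submodules and pure quotients: if 0 → M → H → N → 0 is a pure exact sequence of R-modules with H ∈ I_C, then M ∈ I_C and N ∈ I_C. -/
/-!
Common definitions: Ext/Tor vanishing, semidualizing modules, the Auslander and Bass
classes, (pre)covers and (pre)envelopes, cotorsion pairs, the classes `I_C` and `F_C`,
purity, and Kaplansky classes.
-/

open CategoryTheory

universe u

section

open TensorProduct

variable {R : Type u} [CommRing R]

/-- A finite family of tensors that becomes the constant family `c i ⊗ b` along a pure map is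
already of the form `c i ⊗ a`. -/
theorem exists_eq_tmul_of_lTensor_injective {A B : Type u} [AddCommGroup A] [Module R A]
    [AddCommGroup B] [Module R B] {f : A →ₗ[R] B}
    (hf : ∀ (P : Type u) [AddCommGroup P] [Module R P], Function.Injective (f.lTensor P))
    {P : Type u} [AddCommGroup P] [Module R P] {n : ℕ} {c : Fin n → P} {t : Fin n → P ⊗[R] A}
    {b : B} (h : ∀ i, f.lTensor P (t i) = c i ⊗ₜ b) : ∃ a : A, ∀ i, t i = c i ⊗ₜ a := by
  let q := (LinearMap.toSpanSingleton R (Fin n → P) c).range.mkQ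
  let τ : (Fin n → P) ⊗[R] A := ∑ i, (LinearMap.single R (fun _ => P) i).rTensor A (t i)
  have hτ : f.lTensor (Fin n → P) τ = c ⊗ₜ b := by
    have key (i : Fin n) : f.lTensor (Fin n → P)
        ((LinearMap.single R (fun _ => P) i).rTensor A (t i)) = Pi.single i (c i) ⊗ₜ b := by
      rw [← LinearMap.comp_apply, LinearMap.lTensor_comp_rTensor, ← LinearMap.rTensor_comp_lTensor,
        LinearMap.comp_apply, h, LinearMap.rTensor_tmul, LinearMap.single_apply]
    simp only [τ, map_sum, key]
    rw [← TensorProduct.sum_tmul, Finset.univ_sum_single]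
  have hq : q.rTensor A τ = 0 := by
    apply hf
    rw [← LinearMap.comp_apply, LinearMap.lTensor_comp_rTensor, ← LinearMap.rTensor_comp_lTensor,
      LinearMap.comp_apply, hτ, LinearMap.rTensor_tmul, map_zero,
      show q c = 0 from (Submodule.Quotient.mk_eq_zero _).2 ⟨1, one_smul R c⟩, TensorProduct.zero_tmul]
  have hex : Function.Exact (LinearMap.toSpanSingleton R (Fin n → P) c) q := by
    rw [LinearMap.exact_iff, Submodule.ker_mkQ]
  obtain ⟨s, hs⟩ := (rTensor_exact A hex (Submodule.mkQ_surjective _) τ).1 hq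
  refine ⟨TensorProduct.lid R A s, fun i => ?_⟩
  have hi : (LinearMap.proj i : (Fin n → P) →ₗ[R] P).rTensor A τ = t i := by
    simp only [τ, map_sum]
    rw [Finset.sum_eq_single i]
    · rw [← LinearMap.rTensor_comp_apply, LinearMap.proj_comp_single_same, LinearMap.rTensor_id,
        LinearMap.id_apply]
    · intro j _ hj
      rw [← LinearMap.rTensor_comp_apply, LinearMap.proj_comp_single_ne _ _ _ _ hj.symm,
        LinearMap.rTensor_zero, LinearMap.zero_apply]
    · simp
  rw [← hi, ← hs]
  obtain ⟨a, rfl⟩ := (TensorProduct.lid R A).symm.surjective s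
  simp

theorem Module.Injective.exists_comp_eq {I : Type u} [AddCommGroup I] [Module R I]
    (hI : Module.Injective R I) {X Y : Type u} [AddCommGroup X] [Module R X] [AddCommGroup Y]
    [Module R Y] (T : X →ₗ[R] Y) (φ : X →ₗ[R] I) (h : LinearMap.ker T ≤ LinearMap.ker φ) :
    ∃ ψ : Y →ₗ[R] I, ψ ∘ₗ T = φ := by
  obtain ⟨ψ, hψ⟩ := hI.out ((LinearMap.ker T).liftQ T le_rfl)
    (LinearMap.ker_eq_bot.1 (Submodule.ker_liftQ_eq_bot _ _ _ le_rfl))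
    ((LinearMap.ker T).liftQ φ h)
  exact ⟨ψ, LinearMap.ext fun x => hψ (Submodule.Quotient.mk x)⟩

theorem Module.Injective.of_leftInverse {I J : Type u} [AddCommGroup I] [Module R I]
    [AddCommGroup J] [Module R J] (hI : Module.Injective R I) (i : J →ₗ[R] I) (s : I →ₗ[R] J)
    (h : Function.LeftInverse s i) : Module.Injective R J where
  out X Y _ _ _ _ φ hφ ψ := by
    obtain ⟨χ, hχ⟩ := hI.out φ hφ (i ∘ₗ ψ)
    exact ⟨s ∘ₗ χ, fun x => by simp [hχ, h _]⟩

/-- Over a noetherian ring, injective modules are closed under pure submodules. -/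
theorem Module.Injective.of_lTensor_injective [IsNoetherianRing R] {A B : Type u}
    [AddCommGroup A] [Module R A] [AddCommGroup B] [Module R B] (hB : Module.Injective R B)
    {f : A →ₗ[R] B}
    (hf : ∀ (P : Type u) [AddCommGroup P] [Module R P], Function.Injective (f.lTensor P)) :
    Module.Injective R A := by
  refine Module.Baer.injective fun J φ => ?_
  obtain ⟨e, he⟩ := hB.out J.subtype J.subtype_injective (f ∘ₗ φ)
  obtain ⟨n, p, hp⟩ := Module.Finite.exists_fin' R J
  obtain ⟨a, ha⟩ := exists_eq_tmul_of_lTensor_injective hf (P := R)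
    (c := fun i => (p (Pi.single i 1) : R)) (t := fun i => 1 ⊗ₜ φ (p (Pi.single i 1)))
    (b := e 1) (fun i => by
      have h := he (p (Pi.single i 1))
      rw [LinearMap.lTensor_tmul, ← LinearMap.comp_apply f φ, ← h]
      apply (TensorProduct.lid R B).injective
      simp [← map_smul])
  have key : φ ∘ₗ p = LinearMap.toSpanSingleton R A a ∘ₗ J.subtype ∘ₗ p := by
    refine LinearMap.pi_ext' fun i => LinearMap.ext_ring ?_
    simpa using congrArg (TensorProduct.lid R A) (ha i)
  refine ⟨LinearMap.toSpanSingleton R A a, fun x hx => ?_⟩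
  obtain ⟨y, hy⟩ := hp ⟨x, hx⟩
  have := LinearMap.congr_fun key y
  simp only [LinearMap.comp_apply, hy] at this
  exact this.symm

variable {C : Type u} [AddCommGroup C] [Module R C]

theorem exists_sum_tmul_eq {n : ℕ} {p : (Fin n → R) →ₗ[R] C} (hp : Function.Surjective p)
    {X : Type u} [AddCommGroup X] [Module R X] (t : C ⊗[R] X) :
    ∃ x : Fin n → X, t = ∑ i, p (Pi.single i 1) ⊗ₜ x i := by
  induction t with
  | zero => exact ⟨0, by simp⟩
  | add s t hs ht =>
    obtain ⟨x, rfl⟩ := hs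
    obtain ⟨y, rfl⟩ := ht
    exact ⟨x + y, by simp [TensorProduct.tmul_add, Finset.sum_add_distrib]⟩
  | tmul c x =>
    obtain ⟨r, rfl⟩ := hp c
    refine ⟨fun i => r i • x, ?_⟩
    conv_lhs => rw [pi_eq_sum_univ' r, map_sum, TensorProduct.sum_tmul]
    refine Finset.sum_congr rfl fun i _ => ?_
    rw [map_smul, TensorProduct.smul_tmul]

/-- If every endomorphism of `C` is a unique homothety, then `C ⊗ Hom(C, I) → I` is bijective for
every injective module `I`. -/
theorem epsMap_bijective_of_injective [IsNoetherianRing R] [Module.Finite R C]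
    (hC : Function.Bijective (fun r : R => r • (LinearMap.id : C →ₗ[R] C)))
    {I : Type u} [AddCommGroup I] [Module R I] (hI : Module.Injective R I) :
    Function.Bijective (epsMap R C I) := by
  obtain ⟨n, p, hp⟩ := Module.Finite.exists_fin' R C
  let c : Fin n → C := fun i => p (Pi.single i 1)
  have hpc (r : Fin n → R) : p r = ∑ i, r i • c i := by
    conv_lhs => rw [← Finset.univ_sum_single r, map_sum]
    refine Finset.sum_congr rfl fun i _ => ?_
    rw [← map_smul, ← Pi.single_smul, smul_eq_mul, mul_one]
  constructor
  · rw [injective_iff_map_eq_zero]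
    intro t ht
    obtain ⟨φ, rfl⟩ := exists_sum_tmul_eq hp t
    obtain ⟨m, k, hk⟩ := Module.Finite.exists_fin' R (LinearMap.ker p)
    let T : (Fin n → C) →ₗ[R] (Fin m → C) := LinearMap.pi fun j =>
      ∑ i, (k (Pi.single j 1) : Fin n → R) i • LinearMap.proj i
    have hT : LinearMap.ker T ≤ LinearMap.ker (∑ i, φ i ∘ₗ LinearMap.proj i) := by
      intro x hx
      let e : (Fin n → R) →ₗ[R] C := ∑ i, (LinearMap.proj i).smulRight (x i)
      have he : e ∘ₗ (LinearMap.ker p).subtype ∘ₗ k = 0 := by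
        refine LinearMap.pi_ext' fun j => LinearMap.ext_ring ?_
        simpa [e, T] using congrFun hx j
      have hker : LinearMap.ker p ≤ LinearMap.ker e := by
        intro r hr
        obtain ⟨s, hs⟩ := hk ⟨r, hr⟩
        have := LinearMap.congr_fun he s
        simpa [hs] using this
      let E : C →ₗ[R] C := (LinearMap.ker p).liftQ e hker ∘ₗ
        (p.quotKerEquivOfSurjective hp).symm.toLinearMap
      have hE (r : Fin n → R) : E (p r) = e r := by
        have : (p.quotKerEquivOfSurjective hp).symm (p r) = Submodule.Quotient.mk r := by
          rw [LinearEquiv.symm_apply_eq]; rfl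
        simp only [E, LinearMap.comp_apply, LinearEquiv.coe_coe, this]
        rfl
      obtain ⟨r, hr⟩ := hC.2 E
      have hx' (i : Fin n) : x i = r • c i := by
        have := hE (Pi.single i 1)
        rw [← hr] at this
        simpa [e, c, Pi.single_apply, ite_smul, eq_comm] using this
      have : ∑ i, φ i (c i) = 0 := by simpa [epsMap, c] using ht
      simp [hx', ← Finset.smul_sum, this]
    obtain ⟨ψ, hψ⟩ := hI.exists_comp_eq T _ hT
    have hφ (i : Fin n) : φ i = ∑ j, (k (Pi.single j 1) : Fin n → R) i •
        (ψ ∘ₗ LinearMap.single R (fun _ => C) j) := by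
      ext y
      have h1 := LinearMap.congr_fun hψ (Pi.single i y)
      have h2 : T (Pi.single i y) =
          ∑ j, Pi.single j ((k (Pi.single j 1) : Fin n → R) i • y) := by
        rw [Finset.univ_sum_single]
        ext j
        simp [T, Pi.single_apply]
      have h3 : (∑ i, φ i ∘ₗ LinearMap.proj i) (Pi.single i y) = φ i y := by
        simp only [LinearMap.sum_apply, LinearMap.comp_apply, LinearMap.proj_apply]
        rw [Finset.sum_eq_single i] <;> simp +contextual
      rw [← h3, ← h1, LinearMap.comp_apply, h2, map_sum]
      simp [Pi.single_smul]
    have hrel (j : Fin m) : ∑ i, (k (Pi.single j 1) : Fin n → R) i • c i = 0 := by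
      rw [← hpc]
      exact (k (Pi.single j 1)).2
    calc ∑ i, c i ⊗ₜ[R] φ i
        = ∑ i, ∑ j, ((k (Pi.single j 1) : Fin n → R) i • c i) ⊗ₜ[R]
            (ψ ∘ₗ LinearMap.single R (fun _ => C) j) := by
          refine Finset.sum_congr rfl fun i _ => ?_
          rw [hφ i, TensorProduct.tmul_sum]
          exact Finset.sum_congr rfl fun j _ => (TensorProduct.smul_tmul _ _ _).symm
      _ = 0 := by
          rw [Finset.sum_comm]
          refine Finset.sum_eq_zero fun j _ => ?_
          rw [← TensorProduct.sum_tmul, hrel, TensorProduct.zero_tmul]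
  · intro x
    obtain ⟨ψ, hψ⟩ := hI.exists_comp_eq (LinearMap.toSpanSingleton R (Fin n → C) c)
      (LinearMap.toSpanSingleton R I x) (by
        intro r hr
        have hr' : r • (LinearMap.id : C →ₗ[R] C) = (0 : R) • LinearMap.id := by
          ext y
          obtain ⟨s, rfl⟩ := hp y
          have h (i : Fin n) : r • c i = 0 := congrFun hr i
          rw [LinearMap.smul_apply, LinearMap.id_apply, hpc, Finset.smul_sum]
          simp [smul_comm r, h]
        rw [hC.1 hr']
        exact zero_mem _)
    refine ⟨∑ i, c i ⊗ₜ (ψ ∘ₗ LinearMap.single R (fun _ => C) i), ?_⟩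
    have := LinearMap.congr_fun hψ 1
    simp only [LinearMap.comp_apply, LinearMap.toSpanSingleton_apply, one_smul] at this
    calc _ = ∑ i, ψ (Pi.single i (c i)) := by simp [epsMap]
      _ = x := by rw [← map_sum, Finset.univ_sum_single, this]

theorem etaMap_bijective_of_equiv {H I : Type u} [AddCommGroup H] [Module R H]
    [AddCommGroup I] [Module R I] (e : H ≃ₗ[R] (C →ₗ[R] I))
    (h : Function.Bijective (epsMap R C I)) : Function.Bijective (etaMap R C H) := by
  let E : C ⊗[R] H ≃ₗ[R] I := (e.lTensor C).trans (LinearEquiv.ofBijective _ h)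
  have hE (x : H) : E.toLinearMap ∘ₗ etaMap R C H x = e x := by
    ext c
    simp [E, etaMap, epsMap]
  constructor
  · intro x y hxy
    apply e.injective
    rw [← hE, ← hE, hxy]
  · intro φ
    refine ⟨e.symm (E.toLinearMap ∘ₗ φ), ?_⟩
    ext c
    apply E.injective
    have := LinearMap.congr_fun (hE (e.symm (E.toLinearMap ∘ₗ φ))) c
    simpa using this

variable {M H N : Type u} [AddCommGroup M] [Module R M] [AddCommGroup H] [Module R H]
  [AddCommGroup N] [Module R N] {f : M →ₗ[R] H} {g : H →ₗ[R] N}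

theorem etaMap_bijective_of_pure_left [Module.Finite R C]
    (hf : ∀ (P : Type u) [AddCommGroup P] [Module R P], Function.Injective (f.lTensor P))
    (hinj : Function.Injective f) (h : Function.Bijective (etaMap R C H)) :
    Function.Bijective (etaMap R C M) := by
  constructor
  · intro x y hxy
    apply hinj
    apply h.1
    ext c
    simpa [etaMap] using congrArg (f.lTensor C) (LinearMap.congr_fun hxy c)
  · intro φ
    obtain ⟨n, p, hp⟩ := Module.Finite.exists_fin' R C
    obtain ⟨b, hb⟩ := h.2 (f.lTensor C ∘ₗ φ)
    obtain ⟨a, ha⟩ := exists_eq_tmul_of_lTensor_injective hf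
      (c := fun i => p (Pi.single i 1)) (t := fun i => φ (p (Pi.single i 1))) (b := b)
      (fun i => (LinearMap.congr_fun hb _).symm)
    refine ⟨a, ?_⟩
    rw [← LinearMap.cancel_right hp]
    exact LinearMap.pi_ext' fun i => LinearMap.ext_ring (ha i).symm

theorem etaMap_injective_of_pure_right [Module.Finite R C] (hpure : IsPureExactSeq R f g)
    (h : Function.Injective (etaMap R C H)) : Function.Injective (etaMap R C N) := by
  obtain ⟨-, hex, hsurj, hP⟩ := hpure
  rw [injective_iff_map_eq_zero]
  intro y hy
  obtain ⟨b, rfl⟩ := hsurj y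
  obtain ⟨n, p, hp⟩ := Module.Finite.exists_fin' R C
  have hker (c : C) : ∃ t, f.lTensor C t = c ⊗ₜ b :=
    ((hP C).2.1 _).1 (by simpa [etaMap] using LinearMap.congr_fun hy c)
  choose t ht using hker
  obtain ⟨a, ha⟩ := exists_eq_tmul_of_lTensor_injective (fun P _ _ => (hP P).1)
    (fun i => ht (p (Pi.single i 1)))
  have hab : etaMap R C H (f a) = etaMap R C H b := by
    rw [← LinearMap.cancel_right hp]
    refine LinearMap.pi_ext' fun i => LinearMap.ext_ring ?_
    have := ht (p (Pi.single i 1))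
    rw [ha i] at this
    simpa [etaMap] using this
  rw [← h hab]
  exact hex.apply_apply_eq_zero a

end

/-- If `C` is a semidualizing module over a commutative noetherian ring `R`, then `I_C` is
closed under pure submodules and pure quotients: if `0 → M → H → N → 0` is pure exact and
`H ∈ I_C`, then `M ∈ I_C` and `N ∈ I_C`. -/
theorem IC_closed_under_pure
    (R : Type u) [CommRing R] [IsNoetherianRing R]
    (C : Type u) [AddCommGroup C] [Module R C] (hC : IsSemidualizing R C)
    (M H N : Type u) [AddCommGroup M] [Module R M] [AddCommGroup H] [Module R H]
    [AddCommGroup N] [Module R N]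
    (f : M →ₗ[R] H) (g : H →ₗ[R] N) (hpure : IsPureExactSeq R f g)
    (hH : memIC R C (ModuleCat.of R H)) :
    memIC R C (ModuleCat.of R M) ∧ memIC R C (ModuleCat.of R N) := by
  obtain ⟨hfin, -, hhom⟩ := hC
  obtain ⟨I, hI, ⟨e⟩⟩ := hH
  have hpure' := hpure
  obtain ⟨hinj, hex, hsurj, hP⟩ := hpure'
  have heps := epsMap_bijective_of_injective hhom hI
  have hη := etaMap_bijective_of_equiv e heps
  let E : TensorProduct R C H ≃ₗ[R] I := (e.lTensor C).trans (LinearEquiv.ofBijective _ heps)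
  have hCH : Module.Injective R (TensorProduct R C H) :=
    hI.of_leftInverse E.toLinearMap E.symm.toLinearMap E.left_inv
  have hCf (P : Type u) [AddCommGroup P] [Module R P] :
      Function.Injective ((f.lTensor C).lTensor P) := by
    have h := (hP (TensorProduct R P C)).1
    rw [LinearMap.lTensor_tensor] at h
    simpa using h
  have hCM : Module.Injective R (TensorProduct R C M) := hCH.of_lTensor_injective hCf
  obtain ⟨s, hs⟩ := hCM.out (f.lTensor C) (hP C).1 LinearMap.id
  obtain ⟨-, l, hl⟩ := ((hP C).2.1.split_tfae'.out 1 0 rfl rfl).1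
    ⟨(hP C).2.2, s, LinearMap.ext hs⟩
  have hCN : Module.Injective R (TensorProduct R C N) :=
    hCH.of_leftInverse l (g.lTensor C) (LinearMap.congr_fun hl)
  have hηN : Function.Surjective (etaMap R C N) := fun φ => by
    obtain ⟨b, hb⟩ := hη.2 (l ∘ₗ φ)
    refine ⟨g b, LinearMap.ext fun c => ?_⟩
    calc c ⊗ₜ[R] g b = g.lTensor C (etaMap R C H b c) := rfl
      _ = φ c := by rw [hb]; exact LinearMap.congr_fun hl (φ c)
  exact ⟨⟨ModuleCat.of R (TensorProduct R C M), hCM,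
      ⟨.ofBijective _ (etaMap_bijective_of_pure_left (fun P _ _ => (hP P).1) hinj hη)⟩⟩,
    ⟨ModuleCat.of R (TensorProduct R C N), hCN,
      ⟨.ofBijective _ ⟨etaMap_injective_of_pure_right hpure hη.1, hηN⟩⟩⟩⟩
end

section
/- Let C be a semidualizing module over a commutative noetherian ring R. The class F_C is closed under pure submodules and pure quotients: if 0 → M → H → N → 0 is a pure exact sequence of R-modules with H ∈ F_C, then M ∈ F_C and N ∈ F_C. -/
/-!
Common definitions: Ext/Tor vanishing, semidualizing modules, the Auslander and Bass
classes, (pre)covers and (pre)envelopes, cotorsion pairs, the classes `I_C` and `F_C`,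
purity, and Kaplansky classes.
-/

open CategoryTheory

universe u

section

open TensorProduct

variable {R : Type u} [CommRing R]

lemma LinearMap.exists_comp_eq_of_ker_le {A B D : Type*} [AddCommGroup A] [Module R A]
    [AddCommGroup B] [Module R B] [AddCommGroup D] [Module R D] {p : A →ₗ[R] B}
    (hp : Function.Surjective p) {y : A →ₗ[R] D} (h : ∀ a, p a = 0 → y a = 0) :
    ∃ φ : B →ₗ[R] D, φ ∘ₗ p = y := by
  refine ⟨(LinearMap.ker p).liftQ y (fun a ha ↦ h a ha) ∘ₗ
    (p.quotKerEquivOfSurjective hp).symm, ?_⟩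
  ext a
  have : (p.quotKerEquivOfSurjective hp).symm (p a) = (LinearMap.ker p).mkQ a := by
    rw [LinearEquiv.symm_apply_eq]; rfl
  rw [LinearMap.comp_apply, LinearMap.comp_apply, LinearEquiv.coe_coe, this]
  exact Submodule.liftQ_apply _ _ a

lemma LinearMap.exists_comp_eq_of_exact {A B D E : Type*} [AddCommGroup A] [Module R A]
    [AddCommGroup B] [Module R B] [AddCommGroup D] [Module R D] [AddCommGroup E] [Module R E]
    {f : A →ₗ[R] B} {g : B →ₗ[R] D} (hf : Function.Injective f) (hfg : Function.Exact f g)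
    {b : E →ₗ[R] B} (h : g ∘ₗ b = 0) : ∃ φ : E →ₗ[R] A, f ∘ₗ φ = b := by
  refine ⟨(LinearEquiv.ofInjective f hf).symm ∘ₗ
    b.codRestrict (LinearMap.range f) (fun x ↦ (hfg _).1 (LinearMap.congr_fun h x)), ?_⟩
  ext x
  exact congrArg Subtype.val ((LinearEquiv.ofInjective f hf).apply_symm_apply
    ⟨b x, (hfg _).1 (LinearMap.congr_fun h x)⟩)

/-- Finitely presented modules are projective relative to pure exact sequences. -/
lemma IsPureExactSeq.exists_lift {M H N X : Type u} [AddCommGroup M] [Module R M]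
    [AddCommGroup H] [Module R H] [AddCommGroup N] [Module R N] [AddCommGroup X] [Module R X]
    [Module.FinitePresentation R X] {f : M →ₗ[R] H} {g : H →ₗ[R] N}
    (hpure : IsPureExactSeq R f g) (φ : X →ₗ[R] N) : ∃ h : X →ₗ[R] H, g ∘ₗ h = φ := by
  obtain ⟨hf, hfg, hg, htensor⟩ := hpure
  obtain ⟨k, l, p, i, hp, hip⟩ := Module.FinitePresentation.exists_fin' R X
  obtain ⟨y, hy⟩ := Module.projective_lifting_property g (φ ∘ₗ p) hg
  obtain ⟨z, hz⟩ : ∃ z, f ∘ₗ z = y ∘ₗ i := by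
    apply LinearMap.exists_comp_eq_of_exact hf hfg
    rw [← LinearMap.comp_assoc, hy, LinearMap.comp_assoc, hip.linearMap_comp_eq_zero,
      LinearMap.comp_zero]
  let iT := i.dualMap
  let q := (LinearMap.range iT).mkQ
  have hexact : Function.Exact iT q := LinearMap.exact_map_mkQ_range iT
  have hq : Function.Surjective q := Submodule.mkQ_surjective _
  obtain ⟨t, ht⟩ := (dualTensorHom_bijective (R := R) (M := Fin l → R) (N := M)).2 z
  obtain ⟨s, hs⟩ := (dualTensorHom_bijective (R := R) (M := Fin k → R) (N := H)).2 y
  have hts : LinearMap.lTensor _ f t = LinearMap.rTensor H iT s := by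
    apply (dualTensorHom_bijective (R := R) (M := Fin l → R) (N := H)).1
    refine (LinearMap.congr_fun (dualTensorHom_comp_lTensor f) t).trans (Eq.trans ?_
      (LinearMap.congr_fun (dualTensorHom_comp_rTensor_dualMap i) s).symm)
    rw [LinearMap.comp_apply, LinearMap.comp_apply, ht, hs]
    exact hz
  have hqt : LinearMap.rTensor M q t = 0 := by
    apply (htensor _).1
    rw [map_zero, ← LinearMap.comp_apply, LinearMap.lTensor_comp_rTensor,
      ← LinearMap.rTensor_comp_lTensor, LinearMap.comp_apply, hts]
    exact (rTensor_exact H hexact hq).apply_apply_eq_zero s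
  obtain ⟨t', rfl⟩ := (rTensor_exact M hexact hq _).1 hqt
  replace ht := (LinearMap.congr_fun (dualTensorHom_comp_rTensor_dualMap i) t').symm.trans ht
  set w := dualTensorHom R (Fin k → R) M t'
  obtain ⟨h, hh⟩ := LinearMap.exists_comp_eq_of_ker_le hp (y := y - f ∘ₗ w) (by
    intro a ha
    obtain ⟨b, rfl⟩ := (hip a).1 ha
    have h₁ := LinearMap.congr_fun hz b
    have h₂ := LinearMap.congr_fun ht b
    simp only [LinearMap.comp_apply, LinearMap.lcomp_apply] at h₁ h₂
    simp [w, h₂, h₁])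
  refine ⟨h, ?_⟩
  rw [← LinearMap.cancel_right hp, LinearMap.comp_assoc, hh, LinearMap.comp_sub, hy,
    ← LinearMap.comp_assoc, hfg.linearMap_comp_eq_zero, LinearMap.zero_comp, sub_zero]

/-- Every homomorphism from a finitely generated module to `V` factors through a finite power
of `C`. -/
def FactorsThroughPowers (R : Type u) [CommRing R] (C : Type u) [AddCommGroup C] [Module R C]
    (V : Type u) [AddCommGroup V] [Module R V] : Prop :=
  ∀ (X : Type u) [AddCommGroup X] [Module R X] [Module.Finite R X] (φ : X →ₗ[R] V),
    ∃ (m : ℕ) (a : X →ₗ[R] (Fin m → C)) (b : (Fin m → C) →ₗ[R] V), φ = b ∘ₗ a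

variable {C : Type u} [AddCommGroup C] [Module R C]

variable (R C) in
lemma factorsThroughPowers_tensorProduct [IsNoetherianRing R] (F : Type u) [AddCommGroup F]
    [Module R F] [Module.Flat R F] : FactorsThroughPowers R C (C ⊗[R] F) := by
  intro X _ _ _ φ
  have := Module.finitePresentation_of_finite R X
  obtain ⟨k, l, p, i, hp, hip⟩ := Module.FinitePresentation.exists_fin' R X
  obtain ⟨t, ht⟩ := (rTensorHomEquivHomRTensor R (Fin k → R) C F).surjective (φ ∘ₗ p)
  obtain ⟨n, h, x, rfl⟩ := TensorProduct.exists_sum_tmul_eq t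
  rw [rTensorHomEquivHomRTensor_apply] at ht
  have hvan : ∑ s, (h s ∘ₗ i) ⊗ₜ[R] x s = 0 := by
    apply (rTensorHomEquivHomRTensor R (Fin l → R) C F).injective
    rw [rTensorHomEquivHomRTensor_apply, map_zero]
    ext1 j
    ext1
    have := LinearMap.congr_fun ht (i (Pi.single j 1))
    simpa [hip.apply_apply_eq_zero] using this
  obtain ⟨m, A, y, hxy, hA⟩ :=
    TensorProduct.vanishesTrivially_of_sum_tmul_eq_zero_of_rTensor_injective R
      (Module.Flat.rTensor_preserves_injective_linearMap _ (Submodule.subtype_injective _)) hvan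
  have hlift (j : Fin m) : ∃ h' : X →ₗ[R] C, h' ∘ₗ p = ∑ s, A s j • h s := by
    apply LinearMap.exists_comp_eq_of_ker_le hp
    intro a ha
    obtain ⟨b, rfl⟩ := (hip a).1 ha
    simpa using LinearMap.congr_fun (hA j) b
  choose h' hh' using hlift
  refine ⟨m, LinearMap.pi h', LinearMap.lsum R (fun _ ↦ C) R
    (fun j ↦ (TensorProduct.mk R C F).flip (y j)), ?_⟩
  rw [← LinearMap.cancel_right hp, ← ht]
  ext1 c
  ext1
  have hc (j : Fin m) := LinearMap.congr_fun (hh' j) (Pi.single c 1)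
  simp only [LinearMap.comp_apply] at hc
  simp [hc, hxy, TensorProduct.tmul_sum]
  rw [Finset.sum_comm]

namespace FactorsThroughPowers

lemma of_linearEquiv {V W : Type u} [AddCommGroup V] [Module R V] [AddCommGroup W] [Module R W]
    (hW : FactorsThroughPowers R C W) (e : V ≃ₗ[R] W) : FactorsThroughPowers R C V := by
  intro X _ _ _ φ
  obtain ⟨m, a, b, h⟩ := hW X (e.toLinearMap ∘ₗ φ)
  refine ⟨m, a, e.symm.toLinearMap ∘ₗ b, ?_⟩
  rw [LinearMap.comp_assoc, ← h]
  ext; simp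

variable {M H N : Type u} [AddCommGroup M] [Module R M] [AddCommGroup H] [Module R H]
  [AddCommGroup N] [Module R N] {f : M →ₗ[R] H} {g : H →ₗ[R] N}

lemma of_pure_quotient [IsNoetherianRing R] (hH : FactorsThroughPowers R C H)
    (hpure : IsPureExactSeq R f g) : FactorsThroughPowers R C N := by
  intro X _ _ _ φ
  have := Module.finitePresentation_of_finite R X
  obtain ⟨h, rfl⟩ := hpure.exists_lift φ
  obtain ⟨m, a, b, rfl⟩ := hH X h
  exact ⟨m, a, g ∘ₗ b, rfl⟩

lemma of_pure_submodule [IsNoetherianRing R] [Module.Finite R C]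
    (hH : FactorsThroughPowers R C H)
    (hpure : IsPureExactSeq R f g) : FactorsThroughPowers R C M := by
  intro X _ _ _ φ
  obtain ⟨m, a, b, hab⟩ := hH X (f ∘ₗ φ)
  let q := (LinearMap.range a).mkQ
  have hqa : q ∘ₗ a = 0 := LinearMap.range_mkQ_comp a
  have := Module.finitePresentation_of_finite R ((Fin m → C) ⧸ LinearMap.range a)
  obtain ⟨c, hc⟩ := LinearMap.exists_comp_eq_of_ker_le (p := q) (y := g ∘ₗ b)
    (Submodule.mkQ_surjective _) (by
      intro x hx
      obtain ⟨x, rfl⟩ := (Submodule.Quotient.mk_eq_zero _).1 hx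
      rw [← LinearMap.comp_apply, LinearMap.comp_assoc, ← hab, ← LinearMap.comp_assoc,
        hpure.2.1.linearMap_comp_eq_zero, LinearMap.zero_comp, LinearMap.zero_apply])
  obtain ⟨h, rfl⟩ := hpure.exists_lift c
  obtain ⟨ψ, hψ⟩ := LinearMap.exists_comp_eq_of_exact hpure.1 hpure.2.1 (b := b - h ∘ₗ q)
    (by rw [LinearMap.comp_sub, ← hc, LinearMap.comp_assoc, sub_self])
  refine ⟨m, a, ψ, ?_⟩
  rw [← LinearMap.cancel_left hpure.1, ← LinearMap.comp_assoc, hψ, LinearMap.sub_comp, hab,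
    LinearMap.comp_assoc, hqa, LinearMap.comp_zero, sub_zero]

variable {V : Type u} [AddCommGroup V] [Module R V]

lemma exists_eq_sum_smul (hV : FactorsThroughPowers R C V) (hC : IsSemidualizing R C) {n : ℕ}
    (φ : Fin n → C →ₗ[R] V) :
    ∃ (m : ℕ) (r : Fin n → Fin m → R) (ψ : Fin m → C →ₗ[R] V),
      (∀ i, φ i = ∑ j, r i j • ψ j) ∧
      ∀ c : Fin n → C, ∑ i, φ i (c i) = 0 → ∀ j, ∑ i, r i j • c i = 0 := by
  have : Module.Finite R C := hC.1
  let Φ : (Fin n → C) →ₗ[R] V := LinearMap.lsum R (fun _ ↦ C) R φ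
  have hΦ (c : Fin n → C) : Φ c = ∑ i, φ i (c i) := by simp [Φ]
  let q := (LinearMap.ker Φ).mkQ
  obtain ⟨m, a, b, hab⟩ := hV _ ((LinearMap.ker Φ).liftQ Φ le_rfl)
  choose r hr using fun (i : Fin n) (j : Fin m) ↦
    hC.2.2.2 (LinearMap.proj j ∘ₗ a ∘ₗ q ∘ₗ LinearMap.single R (fun _ ↦ C) i)
  have har (c : Fin n → C) (j : Fin m) : a (q c) j = ∑ i, r i j • c i := by
    conv_lhs => rw [← Finset.univ_sum_single c]
    simp only [map_sum, Finset.sum_apply]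
    refine Finset.sum_congr rfl fun i _ ↦ ?_
    simpa using (LinearMap.congr_fun (hr i j) (c i)).symm
  refine ⟨m, r, fun j ↦ b ∘ₗ LinearMap.single R (fun _ ↦ C) j, fun i ↦ ?_, fun c hc j ↦ ?_⟩
  · ext x
    have h₁ : φ i x = b (a (q (Pi.single i x))) := by
      rw [← LinearMap.comp_apply b, ← hab]
      refine Eq.trans ?_ (Submodule.liftQ_apply _ _ _).symm
      rw [hΦ, Finset.sum_eq_single i (fun s _ hs ↦ by simp [hs]) (by simp), Pi.single_eq_same]
    have h₂ : a (q (Pi.single i x)) = ∑ j, r i j • Pi.single j x := by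
      rw [← Finset.univ_sum_single (a (q (Pi.single i x)))]
      refine Finset.sum_congr rfl fun j _ ↦ ?_
      rw [har, ← Pi.single_smul]
      congr 1
      simp [Pi.single_apply]
    rw [h₁, h₂]
    simp
  · have hqc : q c = 0 := (Submodule.Quotient.mk_eq_zero _).2 ((hΦ c).trans hc)
    rw [← har, hqc, map_zero, Pi.zero_apply]

lemma flat_hom (hV : FactorsThroughPowers R C V) (hC : IsSemidualizing R C) :
    Module.Flat R (C →ₗ[R] V) := by
  refine Module.Flat.of_forall_isTrivialRelation fun {l s φ} hs ↦ ?_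
  obtain ⟨m, r, ψ, hφ, hr⟩ := hV.exists_eq_sum_smul hC φ
  refine ⟨m, r, ψ, hφ, fun j ↦ hC.2.2.1 ?_⟩
  ext c
  have := hr (fun i ↦ s i • c) (by simpa using LinearMap.congr_fun hs c) j
  simpa [Finset.sum_smul, smul_smul, mul_comm] using this

lemma bijective_epsMap (hV : FactorsThroughPowers R C V) (hC : IsSemidualizing R C) :
    Function.Bijective (epsMap R C V) := by
  refine ⟨(injective_iff_map_eq_zero _).2 fun t ht ↦ ?_, fun v ↦ ?_⟩
  · obtain ⟨n, c, φ, rfl⟩ := TensorProduct.exists_sum_tmul_eq t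
    obtain ⟨m, r, ψ, hφ, hr⟩ := hV.exists_eq_sum_smul hC φ
    have h := hr c (by simpa [epsMap] using ht)
    simp_rw [hφ, TensorProduct.tmul_sum, ← TensorProduct.smul_tmul]
    rw [Finset.sum_comm]
    simp_rw [← TensorProduct.sum_tmul, h, TensorProduct.zero_tmul, Finset.sum_const_zero]
  · obtain ⟨m, a, b, hab⟩ := hV R (LinearMap.toSpanSingleton R V v)
    refine ⟨∑ j, a 1 j ⊗ₜ (b ∘ₗ LinearMap.single R (fun _ ↦ C) j), ?_⟩
    have h : v = b (a 1) := by simpa using LinearMap.congr_fun hab 1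
    rw [h, map_sum]
    conv_rhs => rw [← Finset.univ_sum_single (a 1), map_sum]
    simp [epsMap]

lemma memFC (hV : FactorsThroughPowers R C V) (hC : IsSemidualizing R C) :
    memFC R C (ModuleCat.of R V) :=
  ⟨ModuleCat.of R (C →ₗ[R] V), hV.flat_hom hC,
    ⟨(LinearEquiv.ofBijective (epsMap R C V) (hV.bijective_epsMap hC)).symm⟩⟩

end FactorsThroughPowers

end

/-- If `C` is a semidualizing module over a commutative noetherian ring `R`, then `F_C` is
closed under pure submodules and pure quotients: if `0 → M → H → N → 0` is pure exact and
`H ∈ F_C`, then `M ∈ F_C` and `N ∈ F_C`. -/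
theorem FC_closed_under_pure
    (R : Type u) [CommRing R] [IsNoetherianRing R]
    (C : Type u) [AddCommGroup C] [Module R C] (hC : IsSemidualizing R C)
    (M H N : Type u) [AddCommGroup M] [Module R M] [AddCommGroup H] [Module R H]
    [AddCommGroup N] [Module R N]
    (f : M →ₗ[R] H) (g : H →ₗ[R] N) (hpure : IsPureExactSeq R f g)
    (hH : memFC R C (ModuleCat.of R H)) :
    memFC R C (ModuleCat.of R M) ∧ memFC R C (ModuleCat.of R N) := by
  have : Module.Finite R C := hC.1
  obtain ⟨F, hF, ⟨e⟩⟩ := hH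
  have hHC : FactorsThroughPowers R C H :=
    (factorsThroughPowers_tensorProduct R C F).of_linearEquiv e
  exact ⟨(hHC.of_pure_submodule hpure).memFC hC, (hHC.of_pure_quotient hpure).memFC hC⟩
end
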